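/- arXiv:2401.10992 — 3 statements merged into one kernel-verified Lean document; each statement's English description precedes it below -/
import Mathlib

section
/- Let p ∈ (0,∞), let (Ŝ, Δ(·), S(·), I) be a symmetric Mahler sliding family in ℝ², and fix x ∈ ℝ. Then the map (y,t) ↦ ‖(x,y)‖_{S(t)^{∘,p}} is convex on ℝ × I. -/
open MeasureTheory Set

/-- The `L^p`-support function of a body `K ⊆ ℝ²`. -/
noncomputable def suppFn (p : ℝ) (K : Set (ℝ × ℝ)) (y : ℝ × ℝ) : ℝ :=
  (1 / p) * Real.log ((∫ x in K, Real.exp (p * (x.1 * y.1 + x.2 * y.2))) / (volume K).toReal)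

/-- The `L^p`-Mahler volume of `K ⊆ ℝ²`. -/
noncomputable def mahlerVol (p : ℝ) (K : Set (ℝ × ℝ)) : ℝ :=
  (volume K).toReal * ∫ y, Real.exp (-(suppFn p K y))

/-- The near norm of the `L^p`-polar body, for `n = 2`. -/
noncomputable def nearNorm (p : ℝ) (K : Set (ℝ × ℝ)) (y : ℝ × ℝ) : ℝ :=
  if y = 0 then 0
  else (∫ r in Set.Ioi (0 : ℝ), r * Real.exp (-(suppFn p K (r • y)))) ^ (-(1 / 2 : ℝ))

/-- The `L^p`-polar body of `K ⊆ ℝ²`. -/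
noncomputable def lpPolar (p : ℝ) (K : Set (ℝ × ℝ)) : Set (ℝ × ℝ) :=
  {y | nearNorm p K y ≤ 1}

/-- The mass of a positive integrable density on `(0, ∞)` is carried to the uniform measure on
`(0, 1)` by a differentiable quantile function. -/
theorem exists_quantile {F : ℝ → ℝ} (hF : Continuous F) (hpos : ∀ r, 0 < r → 0 < F r)
    (hint : IntegrableOn F (Ioi 0)) :
    0 < ∫ r in Ioi (0 : ℝ), F r ∧ ∃ Q : ℝ → ℝ, ∀ θ ∈ Ioo (0 : ℝ) 1, 0 < Q θ ∧
      HasDerivAt Q ((∫ r in Ioi (0 : ℝ), F r) / F (Q θ)) θ := by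
  set α := ∫ r in Ioi (0 : ℝ), F r with hα
  set G : ℝ → ℝ := fun u => ∫ r in (0 : ℝ)..u, F r with hG
  have hG' : ∀ u, HasDerivAt G (F u) u := fun u =>
    (hF.integral_hasStrictDerivAt 0 u).hasDerivAt
  have hGc : Continuous G := continuous_iff_continuousAt.2 fun u => (hG' u).continuousAt
  have hmono : StrictMonoOn G (Ici 0) := by
    apply strictMonoOn_of_deriv_pos (convex_Ici 0) hGc.continuousOn
    intro u hu
    rw [interior_Ici] at hu
    rw [(hG' u).deriv]
    exact hpos u hu
  have hG0 : G 0 = 0 := by simp [hG]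
  have hlim : Filter.Tendsto G Filter.atTop (nhds α) :=
    intervalIntegral_tendsto_integral_Ioi 0 hint Filter.tendsto_id
  have hle : ∀ u, 0 ≤ u → G u ≤ α := by
    intro u hu
    refine ge_of_tendsto hlim ?_
    filter_upwards [Filter.eventually_ge_atTop u] with v hv
    exact hmono.monotoneOn hu (hu.trans hv) hv
  have hlt : ∀ u, 0 ≤ u → G u < α := fun u hu =>
    (hmono (mem_Ici.2 hu) (mem_Ici.2 (by linarith)) (by linarith : u < u + 1)).trans_le
      (hle (u + 1) (by linarith))
  have hα0 : 0 < α := by simpa [hG0] using hlt 0 le_rfl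
  have hex : ∀ θ, ∃ r, θ ∈ Ioo (0 : ℝ) 1 → 0 < r ∧ G r = α * θ := by
    intro θ
    by_cases hθ : θ ∈ Ioo (0 : ℝ) 1
    · have h1 : α * θ < α := by nlinarith [hθ.2]
      obtain ⟨b, hb0, hb⟩ := ((Filter.eventually_ge_atTop 0).and
        (hlim.eventually (lt_mem_nhds h1))).exists
      obtain ⟨r, hr, hr'⟩ := intermediate_value_Icc hb0 hGc.continuousOn
        (show α * θ ∈ Icc (G 0) (G b) from ⟨by rw [hG0]; nlinarith [hθ.1], hb.le⟩)
      refine ⟨r, fun _ => ⟨lt_of_le_of_ne hr.1 ?_, hr'⟩⟩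
      rintro rfl
      rw [hG0] at hr'
      nlinarith [hθ.1, mul_pos hα0 hθ.1]
    · exact ⟨0, fun h => absurd h hθ⟩
  choose Q hQ using hex
  refine ⟨hα0, Q, fun θ hθ => ⟨(hQ θ hθ).1, ?_⟩⟩
  have hQmono : StrictMonoOn Q (Ioo 0 1) := by
    intro a ha b hb hab
    by_contra! h
    have := hmono.monotoneOn (mem_Ici.2 (hQ b hb).1.le) (mem_Ici.2 (hQ a ha).1.le) h
    rw [(hQ a ha).2, (hQ b hb).2] at this
    nlinarith
  have himg : Ioi 0 ⊆ Q '' Ioo 0 1 := by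
    intro r hr
    have h1 := hmono (mem_Ici.2 le_rfl) (mem_Ici.2 (le_of_lt hr)) hr
    have hmem : G r / α ∈ Ioo (0 : ℝ) 1 :=
      ⟨div_pos (by linarith) hα0, (div_lt_one hα0).2 (hlt r (le_of_lt hr))⟩
    refine ⟨G r / α, hmem, hmono.injOn (hQ _ hmem).1.le (mem_Ici.2 (le_of_lt hr)) ?_⟩
    rw [(hQ _ hmem).2]
    field_simp
  have hcont : ContinuousAt Q θ :=
    hQmono.continuousAt_of_image_mem_nhds (Ioo_mem_nhds hθ.1 hθ.2)
      (Filter.mem_of_superset (Ioi_mem_nhds (hQ θ hθ).1) himg)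
  have hd : HasDerivAt (fun u => G u / α) (F (Q θ) / α) (Q θ) := (hG' _).div_const α
  have := hd.of_local_left_inverse hcont (div_pos (hpos _ (hQ θ hθ).1) hα0).ne' (by
    filter_upwards [Ioo_mem_nhds hθ.1 hθ.2] with y hy
    rw [(hQ y hy).2]
    field_simp)
  rwa [inv_div] at this

/-- Pointwise estimate behind Ball's inequality: the weighted harmonic mean of two quantile
functions moves mass at least at the rate prescribed by the interpolated total mass. -/
theorem ball_pointwise {a b f g h A B m n : ℝ} (ha : 0 < a) (hb : 0 < b) (hf : 0 < f) (hg : 0 < g)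
    (hA : 0 < A) (hB : 0 < B) (hm : 0 < m) (hn : 0 < n) (R : ℝ) (hR : R = (m / a + n / b)⁻¹)
    (hh : f ^ (m * R / a) * g ^ (n * R / b) ≤ h) :
    ((m * A + n * B) ^ 2)⁻¹ ≤
      R * h * (R ^ 2 * (m * ((A ^ 2)⁻¹ / (a * f)) / a ^ 2 + n * ((B ^ 2)⁻¹ / (b * g)) / b ^ 2)) := by
  have hR0 : 0 < R := by rw [hR]; positivity
  set c := m * R / a with hc
  set d := n * R / b with hd
  have hcd : c + d = 1 := by
    have : c + d = (m / a + n / b) * R := by rw [hc, hd]; ring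
    rw [this, hR, mul_inv_cancel₀ (by positivity)]
  have hc0 : 0 < c := by positivity
  have hd0 : 0 < d := by positivity
  set X := R / (a * A) with hX
  set Y := R / (b * B) with hY
  have hX0 : 0 < X := by positivity
  have hY0 : 0 < Y := by positivity
  have h1 := Real.geom_mean_le_arith_mean2_weighted hc0.le hd0.le
    (by positivity : 0 ≤ X ^ 2 / f) (by positivity : 0 ≤ Y ^ 2 / g) hcd
  have h2 := Real.geom_mean_le_arith_mean2_weighted hc0.le hd0.le
    (by positivity : 0 ≤ X⁻¹) (by positivity : 0 ≤ Y⁻¹) hcd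
  have e1 : c * X⁻¹ + d * Y⁻¹ = m * A + n * B := by
    rw [hc, hd, hX, hY]; field_simp
  rw [e1, Real.inv_rpow hX0.le, Real.inv_rpow hY0.le, ← mul_inv] at h2
  have e2 : R * h * (R ^ 2 * (m * ((A ^ 2)⁻¹ / (a * f)) / a ^ 2 +
      n * ((B ^ 2)⁻¹ / (b * g)) / b ^ 2)) = h * (c * (X ^ 2 / f) + d * (Y ^ 2 / g)) := by
    rw [hc, hd, hX, hY]; field_simp
  rw [e2]
  have h3 : ((m * A + n * B) ^ 2)⁻¹ ≤ (X ^ c * Y ^ d) ^ 2 := by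
    rw [inv_le_comm₀ (by positivity) (by positivity), ← inv_pow]
    exact pow_le_pow_left₀ (by positivity) h2 2
  refine h3.trans ?_
  have e3 : (X ^ c * Y ^ d) ^ 2 =
      (f ^ c * g ^ d) * ((X ^ 2 / f) ^ c * (Y ^ 2 / g) ^ d) := by
    rw [Real.div_rpow (by positivity) hf.le, Real.div_rpow (by positivity) hg.le, mul_pow,
      ← Real.rpow_natCast, ← Real.rpow_natCast, ← Real.rpow_natCast, ← Real.rpow_natCast,
      ← Real.rpow_mul hX0.le, ← Real.rpow_mul hX0.le, ← Real.rpow_mul hY0.le,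
      ← Real.rpow_mul hY0.le, mul_comm c, mul_comm d]
    have := (Real.rpow_pos_of_pos hf c).ne'
    have := (Real.rpow_pos_of_pos hg d).ne'
    field_simp
  rw [e3]
  exact mul_le_mul hh h1 (by positivity) (le_trans (by positivity) hh)

/-- **Ball's inequality** for densities `r ↦ r * f r` on the half-line. -/
theorem ball_inequality {f g h : ℝ → ℝ} (hf : Continuous f) (hg : Continuous g) (hh : Continuous h)
    (hf0 : ∀ r, 0 < f r) (hg0 : ∀ r, 0 < g r) (hh0 : ∀ r, 0 < h r)
    (hfi : IntegrableOn (fun r => r * f r) (Ioi 0))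
    (hgi : IntegrableOn (fun r => r * g r) (Ioi 0))
    (hhi : IntegrableOn (fun r => r * h r) (Ioi 0))
    {m n : ℝ} (hm : 0 < m) (hn : 0 < n)
    (H : ∀ a b R, 0 < a → 0 < b → R = (m / a + n / b)⁻¹ →
      f a ^ (m * R / a) * g b ^ (n * R / b) ≤ h R) :
    (∫ r in Ioi (0 : ℝ), r * h r) ^ (-(1 / 2 : ℝ)) ≤
      m * (∫ r in Ioi (0 : ℝ), r * f r) ^ (-(1 / 2 : ℝ)) +
      n * (∫ r in Ioi (0 : ℝ), r * g r) ^ (-(1 / 2 : ℝ)) := by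
  obtain ⟨hα, P, hP⟩ := exists_quantile (by fun_prop) (fun r hr => mul_pos hr (hf0 r)) hfi
  obtain ⟨hβ, Q, hQ⟩ := exists_quantile (by fun_prop) (fun r hr => mul_pos hr (hg0 r)) hgi
  obtain ⟨hγ, -⟩ := exists_quantile (by fun_prop) (fun r hr => mul_pos hr (hh0 r)) hhi
  set α := ∫ r in Ioi (0 : ℝ), r * f r
  set β := ∫ r in Ioi (0 : ℝ), r * g r
  set γ := ∫ r in Ioi (0 : ℝ), r * h r with hγdef
  have key : ∀ z : ℝ, 0 < z → 0 < z ^ (-(1 / 2 : ℝ)) ∧ ((z ^ (-(1 / 2 : ℝ))) ^ 2)⁻¹ = z := by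
    intro z hz
    refine ⟨Real.rpow_pos_of_pos hz _, ?_⟩
    rw [← Real.rpow_natCast, ← Real.rpow_mul hz.le, ← Real.rpow_neg hz.le]
    norm_num
  obtain ⟨hA, hA2⟩ := key α hα
  obtain ⟨hB, hB2⟩ := key β hβ
  obtain ⟨hC, hC2⟩ := key γ hγ
  set A := α ^ (-(1 / 2 : ℝ))
  set B := β ^ (-(1 / 2 : ℝ))
  set C := γ ^ (-(1 / 2 : ℝ))
  set N := m * A + n * B with hN
  have hN0 : 0 < N := by positivity
  set G : ℝ → ℝ := fun u => ∫ r in (0 : ℝ)..u, r * h r with hG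
  have hG' : ∀ u, HasDerivAt G (u * h u) u := fun u =>
    ((by fun_prop : Continuous fun r => r * h r).integral_hasStrictDerivAt 0 u).hasDerivAt
  have hGb : ∀ u, 0 < u → 0 ≤ G u ∧ G u ≤ γ := by
    intro u hu
    simp only [hG]
    rw [intervalIntegral.integral_of_le hu.le]
    refine ⟨setIntegral_nonneg measurableSet_Ioc fun r hr => (mul_pos hr.1 (hh0 r)).le,
      setIntegral_mono_set hhi ?_ Ioc_subset_Ioi_self.eventuallyLE⟩
    filter_upwards [ae_restrict_mem measurableSet_Ioi] with r hr
    exact (mul_pos hr (hh0 r)).le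
  set R : ℝ → ℝ := fun θ => (m / P θ + n / Q θ)⁻¹ with hR
  have hR0 : ∀ θ ∈ Ioo (0 : ℝ) 1, 0 < R θ := by
    intro θ hθ
    have := (hP θ hθ).1
    have := (hQ θ hθ).1
    simp only [hR]
    positivity
  have hR' : ∀ θ ∈ Ioo (0 : ℝ) 1, HasDerivAt R (R θ ^ 2 *
      (m * (α / (P θ * f (P θ))) / P θ ^ 2 + n * (β / (Q θ * g (Q θ))) / Q θ ^ 2)) θ := by
    intro θ hθ
    obtain ⟨hp0, hp⟩ := hP θ hθ
    obtain ⟨hq0, hq⟩ := hQ θ hθ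
    have h1 := (((hasDerivAt_const θ m).div hp hp0.ne').add
      ((hasDerivAt_const θ n).div hq hq0.ne')).inv (by simp; positivity)
    refine h1.congr_deriv ?_
    simp only [hR, Pi.add_apply, Pi.div_apply]
    rw [inv_pow, div_eq_inv_mul]
    ring
  have hψ : ∀ θ ∈ Ioo (0 : ℝ) 1, ∃ D, (N ^ 2)⁻¹ ≤ D ∧ HasDerivAt (fun θ => G (R θ)) D θ := by
    intro θ hθ
    refine ⟨_, ?_, (hG' (R θ)).comp θ (hR' θ hθ)⟩
    have := ball_pointwise (hP θ hθ).1 (hQ θ hθ).1 (hf0 (P θ)) (hg0 (Q θ)) hA hB hm hn (R θ) rfl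
      (H _ _ (R θ) (hP θ hθ).1 (hQ θ hθ).1 rfl)
    rwa [hA2, hB2] at this
  have hNγ : (N ^ 2)⁻¹ ≤ γ := by
    have hstep : ∀ ε, 0 < ε → ε < 1 / 2 → (N ^ 2)⁻¹ * (1 - ε - ε) ≤ γ := by
      intro ε h0 h1
      have e0 : ε ∈ Ioo (0 : ℝ) 1 := ⟨h0, by linarith⟩
      have e1 : 1 - ε ∈ Ioo (0 : ℝ) 1 := ⟨by linarith, by linarith⟩
      have hdiff : ∀ θ ∈ Ioo (0 : ℝ) 1, DifferentiableAt ℝ (fun θ => G (R θ)) θ := by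
        intro θ hθ
        obtain ⟨D, -, hD⟩ := hψ θ hθ
        exact hD.differentiableAt
      have := (convex_Ioo (0 : ℝ) 1).mul_sub_le_image_sub_of_le_deriv
        (f := fun θ => G (R θ)) (C := (N ^ 2)⁻¹)
        (fun θ hθ => (hdiff θ hθ).continuousAt.continuousWithinAt)
        (fun θ hθ => (hdiff θ (interior_subset hθ)).differentiableWithinAt)
        (fun θ hθ => by
          obtain ⟨D, hD1, hD⟩ := hψ θ (interior_subset hθ)
          rwa [hD.deriv]) ε e0 (1 - ε) e1 (by linarith)
      have h2 := (hGb _ (hR0 ε e0)).1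
      have h3 := (hGb _ (hR0 _ e1)).2
      linarith
    by_contra! hlt
    have hM : 0 < (N ^ 2)⁻¹ := by positivity
    have := hstep (((N ^ 2)⁻¹ - γ) / (4 * (N ^ 2)⁻¹)) (div_pos (by linarith) (by linarith))
      (by rw [div_lt_iff₀ (by linarith)]; linarith)
    have e : (N ^ 2)⁻¹ * (1 - ((N ^ 2)⁻¹ - γ) / (4 * (N ^ 2)⁻¹) -
      ((N ^ 2)⁻¹ - γ) / (4 * (N ^ 2)⁻¹)) = ((N ^ 2)⁻¹ + γ) / 2 := by
      field_simp
      ring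
    linarith
  rw [← hC2] at hNγ
  exact (pow_le_pow_iff_left₀ hC.le hN0.le two_ne_zero).1
    ((inv_le_inv₀ (by positivity) (by positivity)).1 hNγ)

theorem aedisjoint_of_interior_inter_eq_empty {A B : Set (ℝ × ℝ)} (hA : Convex ℝ A)
    (hB : Convex ℝ B) (h : interior A ∩ interior B = ∅) : AEDisjoint volume A B := by
  refine measure_mono_null ?_ ((hA.inter hB).addHaar_frontier volume)
  rw [frontier, interior_inter, h, sdiff_empty]
  exact subset_closure

theorem setIntegral_neg_set (f : ℝ × ℝ → ℝ) (D : Set (ℝ × ℝ)) :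
    ∫ w in -D, f w = ∫ w in D, f (-w) := by
  rw [← image_neg_eq_neg]
  exact (Measure.measurePreserving_neg volume).setIntegral_image_emb
    (MeasurableEquiv.neg (ℝ × ℝ)).measurableEmbedding f D

theorem measurePreserving_horizontal_shear {g : ℝ → ℝ} (hg : Measurable g) :
    MeasurePreserving (fun z : ℝ × ℝ => (z.1 + g z.2, z.2)) volume volume := by
  have h := (MeasurePreserving.id (volume : Measure ℝ)).skew_product
    (g := fun c a : ℝ => a + g c) (μc := volume) (μd := volume)
    (by unfold Function.uncurry; fun_prop)
    (Filter.Eventually.of_forall fun c => (measurePreserving_add_right volume (g c)).map_eq)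
  exact (Measure.measurePreserving_swap.comp h).comp Measure.measurePreserving_swap

theorem setIntegral_horizontal_shear {g : ℝ → ℝ} (hg : Measurable g) (f : ℝ × ℝ → ℝ)
    (D : Set (ℝ × ℝ)) :
    ∫ w in (fun z : ℝ × ℝ => (z.1 + g z.2, z.2)) '' D, f w =
      ∫ w in D, f (w.1 + g w.2, w.2) := by
  refine (measurePreserving_horizontal_shear hg).setIntegral_image_emb ?_ f D
  refine Measurable.measurableEmbedding (by fun_prop) ?_
  rintro ⟨a, c⟩ ⟨a', c'⟩ h
  simp only [Prod.mk.injEq] at h ⊢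
  obtain ⟨h1, rfl⟩ := h
  exact ⟨by linarith, rfl⟩

/-- Moving the apex of a triangle parallel to its base is a horizontal shear. -/
theorem convexHull_triangle_eq_shear {x1 x3 y1 y2 : ℝ} (hy : y1 < y2) (t : ℝ) :
    convexHull ℝ ({(x1, y1), (t, y2), (x3, y1)} : Set (ℝ × ℝ)) =
      (fun z : ℝ × ℝ => (z.1 + (z.2 - y1) / (y2 - y1) * t, z.2)) ''
        convexHull ℝ ({(x1, y1), (0, y2), (x3, y1)} : Set (ℝ × ℝ)) := by
  have hne : y2 - y1 ≠ 0 := by linarith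
  let L : ℝ × ℝ →ₗ[ℝ] ℝ × ℝ :=
    (LinearMap.fst ℝ ℝ ℝ + (t / (y2 - y1)) • LinearMap.snd ℝ ℝ ℝ).prod (LinearMap.snd ℝ ℝ ℝ)
  let φ : ℝ × ℝ →ᵃ[ℝ] ℝ × ℝ :=
    L.toAffineMap + AffineMap.const ℝ (ℝ × ℝ) (-(y1 * t / (y2 - y1)), (0 : ℝ))
  have hφ : (fun z : ℝ × ℝ => (z.1 + (z.2 - y1) / (y2 - y1) * t, z.2)) = φ := by
    ext z
    · simp [φ, L]
      field_simp
      ring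
    · simp [φ, L]
  rw [hφ, AffineMap.image_convexHull, ← hφ]
  simp [image_insert_eq, hne]

/-- The exponential integral of a body that splits as `A ∪ D_t ∪ -D_t`, where `D_t` is the
horizontal shear of `D` with velocity profile `s`. -/
noncomputable def slidingMGF (p : ℝ) (A D : Set (ℝ × ℝ)) (s : ℝ → ℝ) (t : ℝ) (u : ℝ × ℝ) : ℝ :=
  (∫ w in A, Real.exp (p * (w.1 * u.1 + w.2 * u.2))) +
  (∫ w in D, Real.exp (p * ((w.1 + s w.2 * t) * u.1 + w.2 * u.2))) +
  ∫ w in D, Real.exp (-(p * ((w.1 + s w.2 * t) * u.1 + w.2 * u.2)))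

theorem setIntegral_exp_log_convex {D : Set (ℝ × ℝ)} (hD : IsCompact D) {e a b : ℝ × ℝ → ℝ}
    (ha : Continuous a) (hb : Continuous b) {c d A B : ℝ} (hc : 0 ≤ c) (hd : 0 ≤ d)
    (hcd : c + d = 1) (hA : 0 < A) (hB : 0 < B) (he : ∀ w, e w = c * a w + d * b w) :
    ∫ w in D, Real.exp (e w) ≤ A ^ c * B ^ d *
      (c / A * (∫ w in D, Real.exp (a w)) + d / B * ∫ w in D, Real.exp (b w)) := by
  obtain rfl : e = fun w => c * a w + d * b w := funext he
  have hi : ∀ {f : ℝ × ℝ → ℝ}, Continuous f → IntegrableOn f D := fun hf =>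
    hf.continuousOn.integrableOn_compact hD
  rw [← integral_const_mul, ← integral_const_mul,
    ← integral_add (hi (by fun_prop)) (hi (by fun_prop)), ← integral_const_mul]
  refine integral_mono (hi (by fun_prop)) (hi (by fun_prop)) fun w => ?_
  have h1 := Real.geom_mean_le_arith_mean2_weighted hc hd
    (by positivity : 0 ≤ Real.exp (a w) / A) (by positivity : 0 ≤ Real.exp (b w) / B) hcd
  rw [Real.div_rpow (Real.exp_nonneg _) hA.le, Real.div_rpow (Real.exp_nonneg _) hB.le,
    ← Real.exp_mul, ← Real.exp_mul] at h1
  have hA' := Real.rpow_pos_of_pos hA c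
  have hB' := Real.rpow_pos_of_pos hB d
  have h2 := mul_le_mul_of_nonneg_left h1 (mul_pos hA' hB').le
  refine le_trans (le_of_eq ?_) (h2.trans (le_of_eq ?_))
  · rw [Real.exp_add]
    field_simp
  · ring

theorem slidingMGF_log_convex {p : ℝ} {A D : Set (ℝ × ℝ)} (hA : IsCompact A) (hD : IsCompact D)
    {s : ℝ → ℝ} (hs : Continuous s) {t t0 t1 : ℝ} {u u0 u1 : ℝ × ℝ} {c d : ℝ} (hc : 0 ≤ c)
    (hd : 0 ≤ d) (hcd : c + d = 1) (h0 : 0 < slidingMGF p A D s t0 u0)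
    (h1 : 0 < slidingMGF p A D s t1 u1) (hu1 : u.1 = c * u0.1 + d * u1.1)
    (hu2 : u.2 = c * u0.2 + d * u1.2) (htu : t * u.1 = c * (t0 * u0.1) + d * (t1 * u1.1)) :
    slidingMGF p A D s t u ≤
      slidingMGF p A D s t0 u0 ^ c * slidingMGF p A D s t1 u1 ^ d := by
  set X := slidingMGF p A D s t0 u0 with hX
  set Y := slidingMGF p A D s t1 u1 with hY
  have e : ∀ w : ℝ × ℝ, p * ((w.1 + s w.2 * t) * u.1 + w.2 * u.2) =
      c * (p * ((w.1 + s w.2 * t0) * u0.1 + w.2 * u0.2)) +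
      d * (p * ((w.1 + s w.2 * t1) * u1.1 + w.2 * u1.2)) := by
    intro w
    linear_combination p * w.1 * hu1 + p * s w.2 * htu + p * w.2 * hu2
  have k1 := setIntegral_exp_log_convex hA (e := fun w => p * (w.1 * u.1 + w.2 * u.2))
    (a := fun w => p * (w.1 * u0.1 + w.2 * u0.2)) (b := fun w => p * (w.1 * u1.1 + w.2 * u1.2))
    (by fun_prop) (by fun_prop) hc hd hcd h0 h1
    (fun w => by linear_combination p * w.1 * hu1 + p * w.2 * hu2)
  have k2 := setIntegral_exp_log_convex hD
    (e := fun w => p * ((w.1 + s w.2 * t) * u.1 + w.2 * u.2))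
    (a := fun w => p * ((w.1 + s w.2 * t0) * u0.1 + w.2 * u0.2))
    (b := fun w => p * ((w.1 + s w.2 * t1) * u1.1 + w.2 * u1.2))
    (by fun_prop) (by fun_prop) hc hd hcd h0 h1 e
  have k3 := setIntegral_exp_log_convex hD
    (e := fun w => -(p * ((w.1 + s w.2 * t) * u.1 + w.2 * u.2)))
    (a := fun w => -(p * ((w.1 + s w.2 * t0) * u0.1 + w.2 * u0.2)))
    (b := fun w => -(p * ((w.1 + s w.2 * t1) * u1.1 + w.2 * u1.2)))
    (by fun_prop) (by fun_prop) hc hd hcd h0 h1 (fun w => by linear_combination - e w)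
  refine (add_le_add (add_le_add k1 k2) k3).trans (le_of_eq ?_)
  have e1 : c / X * X + d / Y * Y = 1 := by
    rw [div_mul_cancel₀ _ h0.ne', div_mul_cancel₀ _ h1.ne', hcd]
  simp only [slidingMGF] at hX hY
  linear_combination (X ^ c * Y ^ d) * e1 - X ^ c * Y ^ d * (c / X) * hX -
    X ^ c * Y ^ d * (d / Y) * hY

theorem slidingMGF_zero (p : ℝ) (A D : Set (ℝ × ℝ)) (s : ℝ → ℝ) (t t' : ℝ) :
    slidingMGF p A D s t 0 = slidingMGF p A D s t' 0 := by
  simp [slidingMGF]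

theorem slidingMGF_vertical {A : Set (ℝ × ℝ)} (hA : A = -A) (p : ℝ) (D : Set (ℝ × ℝ))
    (s : ℝ → ℝ) (t t' η : ℝ) :
    slidingMGF p A D s t (0, η) = slidingMGF p A D s t' (0, |η|) := by
  rcases abs_cases η with ⟨h, -⟩ | ⟨h, -⟩
  · simp [slidingMGF, h]
  · have := setIntegral_neg_set (fun w => Real.exp (p * (w.2 * η))) A
    rw [← hA] at this
    simp only [slidingMGF, h, mul_zero, zero_add, mul_neg, neg_neg, this, Prod.snd_neg, neg_mul]
    ring

theorem setIntegral_exp_eq_slidingMGF {p : ℝ} {A D0 Dt K : Set (ℝ × ℝ)} {s : ℝ → ℝ}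
    (hs : Continuous s) {t : ℝ} (hA : IsCompact A) (hD : IsCompact Dt) (hAc : Convex ℝ A)
    (hDc : Convex ℝ Dt) (hDt : Dt = (fun z : ℝ × ℝ => (z.1 + s z.2 * t, z.2)) '' D0)
    (hK : K = A ∪ Dt ∪ -Dt) (h1 : interior A ∩ interior Dt = ∅)
    (h2 : interior A ∩ interior (-Dt) = ∅) (h3 : interior Dt ∩ interior (-Dt) = ∅)
    (u : ℝ × ℝ) :
    ∫ w in K, Real.exp (p * (w.1 * u.1 + w.2 * u.2)) = slidingMGF p A D0 s t u := by
  have hi : ∀ {E : Set (ℝ × ℝ)}, IsCompact E →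
      IntegrableOn (fun w : ℝ × ℝ => Real.exp (p * (w.1 * u.1 + w.2 * u.2))) E := fun hE =>
    (by fun_prop : Continuous _).continuousOn.integrableOn_compact hE
  have d1 := aedisjoint_of_interior_inter_eq_empty hAc hDc h1
  have d2 := aedisjoint_of_interior_inter_eq_empty hAc hDc.neg h2
  have d3 := aedisjoint_of_interior_inter_eq_empty hDc hDc.neg h3
  rw [hK, setIntegral_union₀ (d2.union_left d3) hD.neg.measurableSet.nullMeasurableSet
    (hi (hA.union hD)) (hi hD.neg), setIntegral_union₀ d1 hD.measurableSet.nullMeasurableSet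
    (hi hA) (hi hD), setIntegral_neg_set, slidingMGF, hDt,
    setIntegral_horizontal_shear (g := fun c => s c * t) (by fun_prop),
    setIntegral_horizontal_shear (g := fun c => s c * t) (by fun_prop)]
  congr 2
  ext w
  simp only [Prod.fst_neg, Prod.snd_neg]
  ring_nf

theorem setIntegral_exp_pos {K : Set (ℝ × ℝ)} (hK : IsCompact K) (hKi : (interior K).Nonempty)
    {f : ℝ × ℝ → ℝ} (hf : Continuous f) : 0 < ∫ w in K, Real.exp (f w) := by
  have : NeZero (volume.restrict K) := by
    refine ⟨fun h => ?_⟩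
    rw [Measure.restrict_eq_zero] at h
    exact (Measure.measure_pos_of_nonempty_interior volume hKi).ne' h
  exact integral_exp_pos
    ((by fun_prop : Continuous fun w => Real.exp (f w)).continuousOn.integrableOn_compact hK)

theorem volume_toReal_pos {K : Set (ℝ × ℝ)} (hK : IsCompact K) (hKi : (interior K).Nonempty) :
    0 < (volume K).toReal :=
  ENNReal.toReal_pos (Measure.measure_pos_of_nonempty_interior volume hKi).ne' hK.measure_ne_top

theorem continuous_exp_neg_suppFn (p : ℝ) {K : Set (ℝ × ℝ)} (hK : IsCompact K)
    (hKi : (interior K).Nonempty) (v : ℝ × ℝ) :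
    Continuous fun r : ℝ => Real.exp (-suppFn p K (r • v)) := by
  have h : Continuous fun r : ℝ =>
      ∫ w in K, Real.exp (p * (w.1 * (r • v).1 + w.2 * (r • v).2)) :=
    continuous_parametric_integral_of_continuous (by unfold Function.uncurry; fun_prop) hK
  simp only [suppFn]
  refine Real.continuous_exp.comp (continuous_const.mul (Continuous.log (h.div_const _) ?_)).neg
  intro r
  exact (div_pos (setIntegral_exp_pos hK hKi (by fun_prop)) (volume_toReal_pos hK hKi)).ne'

theorem integrableOn_mul_exp_neg_suppFn {p : ℝ} (hp : 0 < p) {K : Set (ℝ × ℝ)}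
    (hK : IsCompact K) {v w0 : ℝ × ℝ} (hw0 : w0 ∈ interior K)
    (hv : 0 < w0.1 * v.1 + w0.2 * v.2) :
    IntegrableOn (fun r : ℝ => r * Real.exp (-suppFn p K (r • v))) (Ioi 0) := by
  set δ := (w0.1 * v.1 + w0.2 * v.2) / 2 with hδ
  set U : Set (ℝ × ℝ) := interior K ∩ {w | δ < w.1 * v.1 + w.2 * v.2} with hU
  have hUo : IsOpen U := isOpen_interior.inter (isOpen_lt (by fun_prop) (by fun_prop))
  have hUn : U.Nonempty := ⟨w0, hw0, show δ < _ by rw [hδ]; linarith⟩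
  have hUK : U ⊆ K := inter_subset_left.trans interior_subset
  have hUfin : volume U ≠ ⊤ := ((measure_mono hUK).trans_lt hK.measure_lt_top).ne
  have hUpos : 0 < (volume U).toReal := ENNReal.toReal_pos (hUo.measure_pos volume hUn).ne' hUfin
  have hVpos := volume_toReal_pos hK ⟨w0, hw0⟩
  have hbound : ∀ r : ℝ, 0 < r → Real.exp (-suppFn p K (r • v)) ≤
      Real.exp (-(1 / p * Real.log ((volume U).toReal / (volume K).toReal))) *
        Real.exp (-δ * r) := by
    intro r hr
    have hi : IntegrableOn
        (fun w : ℝ × ℝ => Real.exp (p * (w.1 * (r • v).1 + w.2 * (r • v).2))) K :=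
      (by fun_prop : Continuous _).continuousOn.integrableOn_compact hK
    have h1 : (volume U).toReal * Real.exp (p * (δ * r)) ≤
        ∫ w in K, Real.exp (p * (w.1 * (r • v).1 + w.2 * (r • v).2)) := by
      calc (volume U).toReal * Real.exp (p * (δ * r))
          = ∫ w in U, Real.exp (p * (δ * r)) := by simp [Measure.real]
        _ ≤ ∫ w in U, Real.exp (p * (w.1 * (r • v).1 + w.2 * (r • v).2)) := by
          refine setIntegral_mono_on (integrableOn_const hUfin) (hi.mono_set hUK)
            hUo.measurableSet fun w hw => ?_
          have : δ < w.1 * v.1 + w.2 * v.2 := hw.2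
          refine Real.exp_le_exp.2 (mul_le_mul_of_nonneg_left ?_ hp.le)
          simp only [Prod.smul_fst, Prod.smul_snd, smul_eq_mul]
          nlinarith
        _ ≤ _ := setIntegral_mono_set hi
          (Filter.Eventually.of_forall fun w => (Real.exp_pos _).le) hUK.eventuallyLE
    rw [← Real.exp_add, Real.exp_le_exp, suppFn]
    have h2 : Real.log ((volume U).toReal / (volume K).toReal) + p * (δ * r) ≤
        Real.log ((∫ w in K, Real.exp (p * (w.1 * (r • v).1 + w.2 * (r • v).2))) /
          (volume K).toReal) := by
      rw [← Real.log_exp (p * (δ * r)),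
        ← Real.log_mul (div_pos hUpos hVpos).ne' (Real.exp_pos _).ne', div_mul_eq_mul_div]
      refine Real.log_le_log (by positivity) ?_
      gcongr
    have h3 := mul_le_mul_of_nonneg_left h2 (by positivity : 0 ≤ 1 / p)
    have h4 : 1 / p * (p * (δ * r)) = δ * r := by field_simp
    rw [mul_add, h4] at h3
    linarith
  have hdom := (integrableOn_rpow_mul_exp_neg_mul_rpow (p := 1) (s := 1) (b := δ)
    (by norm_num) one_pos (by rw [hδ]; linarith)).const_mul
      (Real.exp (-(1 / p * Real.log ((volume U).toReal / (volume K).toReal))))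
  simp only [Real.rpow_one] at hdom
  refine hdom.mono' ?_ ?_
  · exact (continuous_id.mul (continuous_exp_neg_suppFn p hK ⟨w0, hw0⟩ v)).aestronglyMeasurable
  · filter_upwards [ae_restrict_mem measurableSet_Ioi] with r hr
    have hr : 0 < r := hr
    rw [Real.norm_of_nonneg (by positivity)]
    have := mul_le_mul_of_nonneg_left (hbound r hr) hr.le
    linarith

theorem exists_mem_interior_inner_pos {K : Set (ℝ × ℝ)} (hK : K = -K)
    (hKi : (interior K).Nonempty) {v : ℝ × ℝ} (hv : v ≠ 0) :
    ∃ w ∈ interior K, 0 < w.1 * v.1 + w.2 * v.2 := by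
  have hneg : ∀ w ∈ interior K, -w ∈ interior K := by
    intro w hw
    have h : interior K = -interior K := by
      conv_lhs => rw [hK]
      exact ((Homeomorph.neg (ℝ × ℝ)).preimage_interior K).symm
    rw [h] at hw
    exact hw
  suffices ∃ w ∈ interior K, w.1 * v.1 + w.2 * v.2 ≠ 0 by
    obtain ⟨w, hw, h⟩ := this
    rcases lt_or_gt_of_ne h with h | h
    · exact ⟨-w, hneg w hw, by simp only [Prod.fst_neg, Prod.snd_neg]; linarith⟩
    · exact ⟨w, hw, h⟩
  by_contra! hzero
  obtain ⟨w, hw⟩ := hKi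
  have hcont : ContinuousAt (fun ε : ℝ => w + ε • v) 0 := by fun_prop
  have hev : ∀ᶠ ε in nhdsWithin (0 : ℝ) (Ioi 0), w + ε • v ∈ interior K :=
    (hcont.eventually_mem (by simpa using isOpen_interior.mem_nhds hw)).filter_mono
      nhdsWithin_le_nhds
  obtain ⟨ε, hε, hε0⟩ := (hev.and self_mem_nhdsWithin).exists
  have e1 := hzero w hw
  have e2 := hzero _ hε
  simp only [Prod.fst_add, Prod.snd_add, Prod.smul_fst, Prod.smul_snd, smul_eq_mul] at e2
  have e3 : ε * (v.1 ^ 2 + v.2 ^ 2) = 0 := by linear_combination e2 - e1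
  have e4 : v.1 ^ 2 + v.2 ^ 2 = 0 := (mul_eq_zero.1 e3).resolve_left (ne_of_gt hε0)
  exact hv (Prod.ext (by simp; nlinarith [sq_nonneg v.1, sq_nonneg v.2])
    (by simp; nlinarith [sq_nonneg v.1, sq_nonneg v.2]))

theorem nearNorm_vertical {p : ℝ} {K : Set (ℝ × ℝ)} {k : ℝ → ℝ}
    (h : ∀ η, suppFn p K (0, η) = k |η|) (y : ℝ) :
    nearNorm p K (0, y) =
      |y| * (∫ r in Ioi (0 : ℝ), r * Real.exp (-k r)) ^ (-(1 / 2 : ℝ)) := by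
  by_cases hy : y = 0
  · subst hy
    simp [nearNorm]
  have hy0 : 0 < |y| := abs_pos.2 hy
  have hne : (0, y) ≠ (0 : ℝ × ℝ) := fun e => hy (congrArg Prod.snd e)
  have hJ : 0 ≤ ∫ r in Ioi (0 : ℝ), r * Real.exp (-k r) :=
    setIntegral_nonneg measurableSet_Ioi fun r (hr : 0 < r) => by positivity
  have e : ∫ r in Ioi (0 : ℝ), r * Real.exp (-suppFn p K (r • (0, y))) =
      (|y| ^ 2)⁻¹ * ∫ r in Ioi (0 : ℝ), r * Real.exp (-k r) := by
    have h1 : ∫ r in Ioi (0 : ℝ), r * Real.exp (-suppFn p K (r • (0, y))) =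
        ∫ r in Ioi (0 : ℝ), (fun q => |y|⁻¹ * (q * Real.exp (-k q))) (r * |y|) := by
      refine setIntegral_congr_fun measurableSet_Ioi fun r (hr : 0 < r) => ?_
      simp only [Prod.smul_mk, smul_eq_mul, mul_zero, h, abs_mul, abs_of_pos hr]
      field_simp
    rw [h1, integral_comp_mul_right_Ioi (fun q => |y|⁻¹ * (q * Real.exp (-k q))) 0 hy0, zero_mul, integral_const_mul, smul_eq_mul]
    field_simp
  rw [nearNorm, if_neg hne, e, Real.mul_rpow (by positivity) hJ]
  congr 1
  rw [Real.inv_rpow (by positivity), Real.rpow_neg (by positivity), inv_inv,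
    ← Real.sqrt_eq_rpow, Real.sqrt_sq hy0.le]

/-- Lemma 4.3: for a symmetric Mahler sliding family `S(·)` on the
interval `I` and fixed `x ∈ ℝ`, the map `(y, t) ↦ ‖(x,y)‖_{S(t)^{∘,p}}` is convex on
`ℝ × I`. -/
theorem sym_norm_convexity (p : ℝ) (hp : 0 < p)
    (x1 x3 y1 y2 : ℝ) (hx : x3 < x1) (hy : y1 < y2)
    (Shat : Set (ℝ × ℝ)) (hScomp : IsCompact Shat) (hSconv : Convex ℝ Shat)
    (hSint : (interior Shat).Nonempty) (hSsym : Shat = -Shat)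
    (hseg : segment ℝ ((x3 : ℝ), y1) ((x1 : ℝ), y1) ⊆ Shat)
    (I : Set ℝ) (hI : Convex ℝ I)
    (Δ : ℝ → Set (ℝ × ℝ))
    (hΔ : ∀ t, Δ t = convexHull ℝ ({(x1, y1), (t, y2), (x3, y1)} : Set (ℝ × ℝ)))
    (S : ℝ → Set (ℝ × ℝ))
    (hS : ∀ t, S t = convexHull ℝ (Shat ∪ ({(t, y2), (-t, -y2)} : Set (ℝ × ℝ))))
    (hdecomp : ∀ t ∈ I, S t = Shat ∪ Δ t ∪ (-Δ t) ∧
      interior Shat ∩ interior (Δ t) = ∅ ∧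
      interior Shat ∩ interior (-Δ t) = ∅ ∧
      interior (Δ t) ∩ interior (-Δ t) = ∅)
    (x : ℝ) :
    ConvexOn ℝ ((Set.univ : Set ℝ) ×ˢ I)
      (fun z : ℝ × ℝ => nearNorm p (S z.2) (x, z.1)) := by
  set s : ℝ → ℝ := fun c => (c - y1) / (y2 - y1) with hs
  have hsc : Continuous s := by fun_prop
  set D : Set (ℝ × ℝ) := convexHull ℝ {(x1, y1), (0, y2), (x3, y1)} with hD
  have hfin : ∀ t : ℝ, ({(x1, y1), (t, y2), (x3, y1)} : Set (ℝ × ℝ)).Finite := fun t =>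
    Set.toFinite _
  have hDcomp : IsCompact D := (hfin 0).isCompact_convexHull ℝ
  have hΔcomp : ∀ t, IsCompact (Δ t) := fun t => by
    rw [hΔ]
    exact (hfin t).isCompact_convexHull ℝ
  have hScompact : ∀ t ∈ I, IsCompact (S t) := fun t ht => by
    rw [(hdecomp t ht).1]
    exact (hScomp.union (hΔcomp t)).union (hΔcomp t).neg
  have hSneg : ∀ t ∈ I, S t = -S t := fun t ht => by
    rw [(hdecomp t ht).1, Set.union_neg, Set.union_neg, neg_neg, ← hSsym, Set.union_assoc,
      Set.union_assoc, Set.union_comm (Δ t)]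
  have hSi : ∀ t ∈ I, (interior (S t)).Nonempty := fun t ht => by
    refine hSint.mono (interior_mono ?_)
    rw [(hdecomp t ht).1, Set.union_assoc]
    exact subset_union_left
  have hmgf : ∀ t ∈ I, ∀ u : ℝ × ℝ, ∫ w in S t, Real.exp (p * (w.1 * u.1 + w.2 * u.2)) =
      slidingMGF p Shat D s t u := fun t ht u => by
    obtain ⟨hu, h1, h2, h3⟩ := hdecomp t ht
    exact setIntegral_exp_eq_slidingMGF hsc hScomp (hΔcomp t) hSconv
      (by rw [hΔ]; exact convex_convexHull ℝ _)
      (by rw [hΔ]; exact convexHull_triangle_eq_shear hy t) hu h1 h2 h3 u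
  set V := slidingMGF p Shat D s 0 0 with hV
  have hvol : ∀ t ∈ I, (volume (S t)).toReal = V := fun t ht => by
    rw [hV, slidingMGF_zero p Shat D s 0 t, ← hmgf t ht 0]
    simp [Measure.real]
  have hsupp : ∀ t ∈ I, ∀ u : ℝ × ℝ,
      suppFn p (S t) u = 1 / p * Real.log (slidingMGF p Shat D s t u / V) := fun t ht u => by
    rw [suppFn, hmgf t ht, hvol t ht]
  have hpos : ∀ t ∈ I, ∀ u : ℝ × ℝ, 0 < slidingMGF p Shat D s t u := fun t ht u => by
    rw [← hmgf t ht u]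
    exact setIntegral_exp_pos (hScompact t ht) (hSi t ht) (by fun_prop)
  refine convexOn_iff_forall_pos.2 ⟨convex_univ.prod hI, ?_⟩
  rintro ⟨η0, t0⟩ ⟨-, ht0⟩ ⟨η1, t1⟩ ⟨-, ht1⟩ m n hm hn hmn
  have ht : m * t0 + n * t1 ∈ I := hI ht0 ht1 hm.le hn.le hmn
  simp only [Prod.smul_mk, Prod.mk_add_mk, smul_eq_mul] at ht0 ht1 ⊢
  have hV0 : 0 < V := by
    rw [← hvol t0 ht0]
    exact volume_toReal_pos (hScompact t0 ht0) (hSi t0 ht0)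
  by_cases hx0 : x = 0
  · subst hx0
    obtain ⟨k, hvert⟩ : ∃ k : ℝ → ℝ, ∀ t ∈ I, ∀ η, suppFn p (S t) (0, η) = k |η| :=
      ⟨fun η => 1 / p * Real.log (slidingMGF p Shat D s 0 (0, η) / V), fun t ht η => by
        rw [hsupp t ht, slidingMGF_vertical hSsym p D s t 0 η]⟩
    rw [nearNorm_vertical (hvert _ ht), nearNorm_vertical (hvert _ ht0),
      nearNorm_vertical (hvert _ ht1), ← mul_assoc, ← mul_assoc, ← add_mul]
    refine mul_le_mul_of_nonneg_right ?_ (Real.rpow_nonneg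
      (setIntegral_nonneg measurableSet_Ioi fun r (hr : 0 < r) => by positivity) _)
    refine (abs_add_le _ _).trans (le_of_eq ?_)
    rw [abs_mul, abs_mul, abs_of_pos hm, abs_of_pos hn]
  · have hne : ∀ η : ℝ, (x, η) ≠ (0 : ℝ × ℝ) := fun η h => hx0 (congrArg Prod.fst h)
    have hcont : ∀ t ∈ I, ∀ η : ℝ, Continuous fun r : ℝ =>
        Real.exp (-suppFn p (S t) (r • (x, η))) := fun t ht η =>
      continuous_exp_neg_suppFn p (hScompact t ht) (hSi t ht) _
    have hint : ∀ t ∈ I, ∀ η : ℝ, IntegrableOn (fun r : ℝ =>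
        r * Real.exp (-suppFn p (S t) (r • (x, η)))) (Ioi 0) := fun t ht η => by
      obtain ⟨w, hw, hw0⟩ := exists_mem_interior_inner_pos (hSneg t ht) (hSi t ht) (hne η)
      exact integrableOn_mul_exp_neg_suppFn hp (hScompact t ht) hw hw0
    simp only [nearNorm, if_neg (hne _)]
    refine ball_inequality (hcont _ ht0 _) (hcont _ ht1 _) (hcont _ ht _)
      (fun _ => Real.exp_pos _) (fun _ => Real.exp_pos _) (fun _ => Real.exp_pos _)
      (hint _ ht0 _) (hint _ ht1 _) (hint _ ht _) hm hn ?_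
    intro a b R ha hb hR
    have hR0 : 0 < R := by rw [hR]; positivity
    have hcd : m * R / a + n * R / b = 1 := by
      have : m * R / a + n * R / b = (m / a + n / b) * R := by ring
      rw [this, hR, mul_inv_cancel₀ (by positivity)]
    have hca : m * R / a * a = m * R := by field_simp
    have hdb : n * R / b * b = n * R := by field_simp
    set c := m * R / a with hc
    set d := n * R / b with hd
    have hc0 : 0 ≤ c := by positivity
    have hd0 : 0 ≤ d := by positivity
    have hX := hpos t0 ht0 (a • (x, η0))
    have hY := hpos t1 ht1 (b • (x, η1))
    have hM := hpos _ ht (R • (x, m * η0 + n * η1))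
    have hlc := slidingMGF_log_convex (p := p) hScomp hDcomp hsc
      (t := m * t0 + n * t1) (u := R • (x, m * η0 + n * η1)) hc0 hd0 hcd hX hY
      (by simp only [Prod.smul_mk, smul_eq_mul]
          linear_combination -x * hca - x * hdb - R * x * hmn)
      (by simp only [Prod.smul_mk, smul_eq_mul]
          linear_combination -η0 * hca - η1 * hdb)
      (by simp only [Prod.smul_mk, smul_eq_mul]
          linear_combination -t0 * x * hca - t1 * x * hdb)
    have hlog := Real.log_le_log hM hlc
    rw [Real.log_mul (Real.rpow_pos_of_pos hX _).ne' (Real.rpow_pos_of_pos hY _).ne',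
      Real.log_rpow hX, Real.log_rpow hY] at hlog
    rw [← Real.exp_mul, ← Real.exp_mul, ← Real.exp_add, Real.exp_le_exp, hsupp _ ht,
      hsupp _ ht0, hsupp _ ht1, Real.log_div hM.ne' hV0.ne', Real.log_div hX.ne' hV0.ne',
      Real.log_div hY.ne' hV0.ne']
    have := mul_le_mul_of_nonneg_left hlog (by positivity : 0 ≤ 1 / p)
    have e : 1 / p * Real.log V * (c + d) = 1 / p * Real.log V := by rw [hcd, mul_one]
    nlinarith
end

section
/- Let p ∈ (0,∞), let (P̂, Δ(·), P(·), I) be a Mahler sliding family in ℝ², and fix x ∈ ℝ. Then the map (y, t, x_0) ↦ ‖(x,y)‖_{(P(t)−(x_0,0))^{∘,p}} is convex on ℝ × I × ℝ. -/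
open MeasureTheory Set

theorem exists_inverse_cdf {g : ℝ → ℝ} (hg : Continuous g) (hpos : ∀ r, 0 < r → 0 < g r)
    {R : ℝ} (hR : 0 < R) :
    ∃ u : ℝ → ℝ, StrictMonoOn u (Ioo 0 1) ∧ ∀ s ∈ Ioo (0 : ℝ) 1,
      0 < u s ∧ HasDerivAt u ((∫ r in (0 : ℝ)..R, g r) / g (u s)) s := by
  set F : ℝ → ℝ := fun r => ∫ x in (0 : ℝ)..r, g x with hF
  have hderiv : ∀ r, HasDerivAt F (g r) r := fun r =>
    intervalIntegral.integral_hasDerivAt_right (hg.intervalIntegrable _ _)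
      hg.aestronglyMeasurable.stronglyMeasurableAtFilter hg.continuousAt
  have hcont : Continuous F := continuous_iff_continuousAt.2 fun r => (hderiv r).continuousAt
  have hmono : StrictMonoOn F (Ici 0) := by
    refine strictMonoOn_of_deriv_pos (convex_Ici 0) hcont.continuousOn fun r hr => ?_
    rw [(hderiv r).deriv]
    rw [interior_Ici] at hr
    exact hpos r hr
  have hF0 : F 0 = 0 := by simp [hF]
  have hA : 0 < F R := hF0 ▸ hmono self_mem_Ici hR.le hR
  have hex : ∀ s, ∃ r, s ∈ Ioo (0 : ℝ) 1 → r ∈ Ioo 0 R ∧ F r = s * F R := by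
    intro s
    by_cases hs : s ∈ Ioo (0 : ℝ) 1
    · have h1 : s * F R ∈ Ioo (F 0) (F R) := by
        rw [hF0]
        exact ⟨mul_pos hs.1 hA, by nlinarith [hs.2]⟩
      obtain ⟨r, hr, hr'⟩ := intermediate_value_Ioo hR.le hcont.continuousOn h1
      exact ⟨r, fun _ => ⟨hr, hr'⟩⟩
    · exact ⟨0, fun h => absurd h hs⟩
  choose u hu using hex
  have humono : StrictMonoOn u (Ioo 0 1) := by
    intro s hs s' hs' hlt
    have h1 := hu s hs
    have h2 := hu s' hs'
    rw [← hmono.lt_iff_lt h1.1.1.le h2.1.1.le, h1.2, h2.2]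
    exact mul_lt_mul_of_pos_right hlt hA
  have himage : Ioo 0 R ⊆ u '' Ioo 0 1 := by
    intro r hr
    have h0 : 0 < F r := hF0 ▸ hmono self_mem_Ici hr.1.le hr.1
    have h1 : F r < F R := hmono hr.1.le hR.le hr.2
    have hs : F r / F R ∈ Ioo (0 : ℝ) 1 := ⟨by positivity, (div_lt_one hA).2 h1⟩
    refine ⟨F r / F R, hs, ?_⟩
    have h2 := hu _ hs
    refine hmono.injOn h2.1.1.le hr.1.le ?_
    rw [h2.2]
    field_simp
  refine ⟨u, humono, fun s hs => ⟨(hu s hs).1.1, ?_⟩⟩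
  have hnhds := isOpen_Ioo.mem_nhds hs
  have hucont : ContinuousAt u s := humono.continuousAt_of_image_mem_nhds hnhds
    (Filter.mem_of_superset (isOpen_Ioo.mem_nhds (hu s hs).1) himage)
  have h := HasDerivAt.of_local_left_inverse (f := fun r => F r / F R) hucont
    ((hderiv (u s)).div_const (F R))
    (div_pos (hpos _ (hu s hs).1.1) hA).ne'
    (by
      filter_upwards [hnhds] with y hy
      rw [(hu y hy).2]
      field_simp)
  rwa [inv_div] at h

theorem harmonic_jacobian_bound {a b u v c d f₁ f₂ m τ : ℝ} (ha : 0 < a) (hb : 0 < b)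
    (hu : 0 < u) (hv : 0 < v) (hc : 0 < c) (hd : 0 < d) (hf₁ : 0 < f₁) (hf₂ : 0 < f₂)
    (hτ : τ = (a / u + b / v)⁻¹)
    (hm : f₁ ^ (a * τ / u) * f₂ ^ (b * τ / v) ≤ m) :
    ((a / c + b / d) ^ 2)⁻¹ ≤
      τ ^ 2 * (a * (c ^ 2 / (u * f₁)) / u ^ 2 + b * (d ^ 2 / (v * f₂)) / v ^ 2) * (τ * m) := by
  have hτ0 : 0 < τ := by rw [hτ]; positivity
  set α := a * τ / u with hα
  set β := b * τ / v with hβ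
  have hα0 : 0 < α := by positivity
  have hβ0 : 0 < β := by positivity
  have hαβ : α + β = 1 := by
    have : α + β = τ * (a / u + b / v) := by rw [hα, hβ]; ring
    rw [this, hτ]
    exact inv_mul_cancel₀ (by positivity)
  have h1 := Real.geom_mean_le_arith_mean2_weighted hα0.le hβ0.le
    (p₁ := c ^ 2 / (u ^ 2 * f₁)) (p₂ := d ^ 2 / (v ^ 2 * f₂)) (by positivity) (by positivity) hαβ
  have h2 := Real.geom_mean_le_arith_mean2_weighted hα0.le hβ0.le
    (p₁ := u / (τ * c)) (p₂ := v / (τ * d)) (by positivity) (by positivity) hαβ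
  have e2 : α * (u / (τ * c)) + β * (v / (τ * d)) = a / c + b / d := by
    rw [hα, hβ]; field_simp
  rw [e2] at h2
  set G := (u / (τ * c)) ^ α * (v / (τ * d)) ^ β with hG
  have hG0 : 0 < G := by positivity
  have key : τ ^ 2 * ((c ^ 2 / (u ^ 2 * f₁)) ^ α * (d ^ 2 / (v ^ 2 * f₂)) ^ β) *
      (f₁ ^ α * f₂ ^ β) = (G ^ 2)⁻¹ := by
    have e3 : (c ^ 2 / (u ^ 2 * f₁)) ^ α * f₁ ^ α = ((u / (τ * c)) ^ α)⁻¹ ^ 2 * (τ⁻¹ ^ α) ^ 2 := by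
      rw [← Real.inv_rpow (by positivity), Real.rpow_pow_comm (by positivity),
        Real.rpow_pow_comm (by positivity), ← Real.mul_rpow (by positivity) (by positivity),
        ← Real.mul_rpow (by positivity) (by positivity)]
      congr 1
      field_simp
    have e4 : (d ^ 2 / (v ^ 2 * f₂)) ^ β * f₂ ^ β = ((v / (τ * d)) ^ β)⁻¹ ^ 2 * (τ⁻¹ ^ β) ^ 2 := by
      rw [← Real.inv_rpow (by positivity), Real.rpow_pow_comm (by positivity),
        Real.rpow_pow_comm (by positivity), ← Real.mul_rpow (by positivity) (by positivity),
        ← Real.mul_rpow (by positivity) (by positivity)]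
      congr 1
      field_simp
    have e5 : τ⁻¹ ^ α * τ⁻¹ ^ β = τ⁻¹ := by
      rw [← Real.rpow_add (by positivity), hαβ, Real.rpow_one]
    calc _ = τ ^ 2 * ((c ^ 2 / (u ^ 2 * f₁)) ^ α * f₁ ^ α) *
          ((d ^ 2 / (v ^ 2 * f₂)) ^ β * f₂ ^ β) := by ring
      _ = τ ^ 2 * (τ⁻¹ ^ α * τ⁻¹ ^ β) ^ 2 * (G ^ 2)⁻¹ := by
        rw [e3, e4, hG]; ring
      _ = _ := by rw [e5]; field_simp
  calc ((a / c + b / d) ^ 2)⁻¹ ≤ (G ^ 2)⁻¹ := by gcongr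
    _ = _ := key.symm
    _ ≤ τ ^ 2 * (α * (c ^ 2 / (u ^ 2 * f₁)) + β * (d ^ 2 / (v ^ 2 * f₂))) * m := by
      gcongr
    _ = _ := by rw [hα, hβ]; field_simp

/-- Ball's inequality for truncated radial integrals. -/
theorem harmonic_radial_integral_le {f₁ f₂ m : ℝ → ℝ} (hf₁ : Continuous f₁) (hf₂ : Continuous f₂)
    (hf₁0 : ∀ r, 0 < f₁ r) (hf₂0 : ∀ r, 0 < f₂ r) (hm0 : ∀ r, 0 < m r)
    {a b : ℝ} (ha : 0 < a) (hb : 0 < b)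
    (hm : ∀ u v, 0 < u → 0 < v →
      f₁ u ^ (a * (a / u + b / v)⁻¹ / u) * f₂ v ^ (b * (a / u + b / v)⁻¹ / v) ≤
        m (a / u + b / v)⁻¹)
    (hint : IntegrableOn (fun r => r * m r) (Ioi 0)) {R S : ℝ} (hR : 0 < R) (hS : 0 < S) :
    (∫ r in Ioi 0, r * m r) ^ (-(1 / 2 : ℝ)) ≤
      a * (∫ r in (0 : ℝ)..R, r * f₁ r) ^ (-(1 / 2 : ℝ)) +
      b * (∫ r in (0 : ℝ)..S, r * f₂ r) ^ (-(1 / 2 : ℝ)) := by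
  have hg₁ : Continuous fun r => r * f₁ r := continuous_id.mul hf₁
  have hg₂ : Continuous fun r => r * f₂ r := continuous_id.mul hf₂
  obtain ⟨u, hu, hu'⟩ := exists_inverse_cdf hg₁ (fun r hr => mul_pos hr (hf₁0 r)) hR
  obtain ⟨v, hv, hv'⟩ := exists_inverse_cdf hg₂ (fun r hr => mul_pos hr (hf₂0 r)) hS
  have hA : 0 < ∫ r in (0 : ℝ)..R, r * f₁ r :=
    intervalIntegral.intervalIntegral_pos_of_pos_on (hg₁.intervalIntegrable _ _)
      (fun r hr => mul_pos hr.1 (hf₁0 r)) hR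
  have hB : 0 < ∫ r in (0 : ℝ)..S, r * f₂ r :=
    intervalIntegral.intervalIntegral_pos_of_pos_on (hg₂.intervalIntegrable _ _)
      (fun r hr => mul_pos hr.1 (hf₂0 r)) hS
  set A := ∫ r in (0 : ℝ)..R, r * f₁ r
  set B := ∫ r in (0 : ℝ)..S, r * f₂ r
  have hpow : ∀ x : ℝ, 0 < x → x ^ (-(1 / 2 : ℝ)) = (√x)⁻¹ := fun x hx => by
    rw [Real.rpow_neg hx.le, Real.sqrt_eq_rpow]
  set τ : ℝ → ℝ := fun s => (a / u s + b / v s)⁻¹ with hτ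
  set τ' : ℝ → ℝ := fun s => τ s ^ 2 * (a * (A / (u s * f₁ (u s))) / u s ^ 2 +
    b * (B / (v s * f₂ (v s))) / v s ^ 2) with hτ'
  have hτpos : ∀ s ∈ Ioo (0 : ℝ) 1, 0 < τ s := fun s hs => by
    have := (hu' s hs).1
    have := (hv' s hs).1
    positivity
  have hτderiv : ∀ s ∈ Ioo (0 : ℝ) 1, HasDerivAt τ (τ' s) s := fun s hs => by
    obtain ⟨hu0, hud⟩ := hu' s hs
    obtain ⟨hv0, hvd⟩ := hv' s hs
    have h1 := ((((hasDerivAt_const s a).div hud hu0.ne').add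
      ((hasDerivAt_const s b).div hvd hv0.ne')).inv
      (by simp only [Pi.add_apply, Pi.div_apply]; positivity))
    refine h1.congr_deriv ?_
    simp only [hτ', hτ, Pi.add_apply, Pi.div_apply, inv_pow]
    ring
  have hτ'0 : ∀ s ∈ Ioo (0 : ℝ) 1, 0 ≤ τ' s := fun s hs => by
    have := (hu' s hs).1
    have := (hv' s hs).1
    have := hf₁0 (u s)
    have := hf₂0 (v s)
    positivity
  have hτinj : InjOn τ (Ioo 0 1) := by
    refine StrictMonoOn.injOn fun s hs s' hs' hlt => ?_
    have h1 := (hu' s hs).1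
    have h2 := (hv' s hs).1
    have h3 := (hu' s' hs').1
    have h4 := (hv' s' hs').1
    have h5 := hu hs hs' hlt
    have h6 := hv hs hs' hlt
    simp only [hτ]
    gcongr
  have hsub : τ '' Ioo 0 1 ⊆ Ioi 0 := by
    rintro _ ⟨s, hs, rfl⟩
    exact hτpos s hs
  have hderivW : ∀ s ∈ Ioo (0 : ℝ) 1, HasDerivWithinAt τ (τ' s) (Ioo 0 1) s :=
    fun s hs => (hτderiv s hs).hasDerivWithinAt
  have hint' := (integrableOn_image_iff_integrableOn_abs_deriv_smul measurableSet_Ioo hderivW hτinj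
    (fun r => r * m r)).1 (hint.mono_set hsub)
  set C := ((a / √A + b / √B) ^ 2)⁻¹ with hC
  have hAs : 0 < √A := Real.sqrt_pos.2 hA
  have hBs : 0 < √B := Real.sqrt_pos.2 hB
  have hle : C ≤ ∫ r in Ioi 0, r * m r := by
    calc C = ∫ s in Ioo (0 : ℝ) 1, C := by simp
      _ ≤ ∫ s in Ioo (0 : ℝ) 1, |τ' s| • (τ s * m (τ s)) := by
        refine setIntegral_mono_on (by simp) hint' measurableSet_Ioo fun s hs => ?_
        rw [abs_of_nonneg (hτ'0 s hs), smul_eq_mul]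
        have h := harmonic_jacobian_bound (τ := τ s) ha hb (hu' s hs).1 (hv' s hs).1 hAs hBs
          (hf₁0 (u s)) (hf₂0 (v s)) rfl (hm _ _ (hu' s hs).1 (hv' s hs).1)
        rwa [Real.sq_sqrt hA.le, Real.sq_sqrt hB.le] at h
      _ = ∫ r in τ '' Ioo 0 1, r * m r :=
        (integral_image_eq_integral_abs_deriv_smul measurableSet_Ioo hderivW hτinj
          (fun r => r * m r)).symm
      _ ≤ ∫ r in Ioi 0, r * m r :=
        setIntegral_mono_set hint
          ((ae_restrict_mem measurableSet_Ioi).mono fun r hr => (mul_pos hr (hm0 r)).le)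
          hsub.eventuallyLE
  have hC0 : 0 < C := by positivity
  rw [hpow _ hA, hpow _ hB]
  calc _ ≤ C ^ (-(1 / 2 : ℝ)) := Real.rpow_le_rpow_of_nonpos hC0 hle (by norm_num)
    _ = _ := by
      rw [hpow _ hC0, hC, Real.sqrt_inv, Real.sqrt_sq (by positivity), inv_inv]
      ring

theorem tendsto_truncated_radial {f : ℝ → ℝ} (hf : Continuous f) (hf0 : ∀ r, 0 < f r) :
    Filter.Tendsto (fun R => (∫ r in (0 : ℝ)..R, r * f r) ^ (-(1 / 2 : ℝ))) Filter.atTop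
      (nhds ((∫ r in Ioi 0, r * f r) ^ (-(1 / 2 : ℝ)))) := by
  have hg : Continuous fun r => r * f r := continuous_id.mul hf
  by_cases hint : IntegrableOn (fun r => r * f r) (Ioi 0)
  · have h := intervalIntegral_tendsto_integral_Ioi 0 hint Filter.tendsto_id
    refine h.rpow_const (Or.inl (ne_of_gt ?_))
    rw [setIntegral_pos_iff_support_of_nonneg_ae
      ((ae_restrict_mem measurableSet_Ioi).mono fun r hr => (mul_pos hr (hf0 r)).le) hint]
    have : Ioi (0 : ℝ) ⊆ Function.support (fun r => r * f r) ∩ Ioi 0 := fun r hr =>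
      ⟨(mul_pos hr (hf0 r)).ne', hr⟩
    exact lt_of_lt_of_le (by simp) (measure_mono this)
  · rw [integral_undef hint, Real.zero_rpow (by norm_num)]
    refine (tendsto_rpow_neg_atTop (by norm_num : (0 : ℝ) < 1 / 2)).comp ?_
    have hmono : MonotoneOn (fun R => ∫ r in (0 : ℝ)..R, r * f r) (Ici 0) := by
      intro s hs t ht hst
      refine intervalIntegral.integral_mono_interval le_rfl hs hst ?_
        (hg.intervalIntegrable _ _)
      exact (ae_restrict_mem measurableSet_Ioc).mono fun r hr => (mul_pos hr.1 (hf0 r)).le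
    rw [Filter.tendsto_atTop]
    by_contra! hcon
    obtain ⟨M, hM⟩ := hcon
    refine hint (integrableOn_Ioi_of_intervalIntegral_norm_bounded M 0
      (fun R => hg.integrableOn_Ioc) Filter.tendsto_id ?_)
    filter_upwards [Filter.eventually_ge_atTop 0] with R hR
    obtain ⟨T, hT, hTR⟩ := (hM.and_eventually (Filter.eventually_ge_atTop R)).exists
    calc ∫ r in (0 : ℝ)..R, ‖r * f r‖ = ∫ r in (0 : ℝ)..R, r * f r := by
          refine intervalIntegral.integral_congr fun r hr => ?_
          rw [uIcc_of_le hR] at hr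
          exact Real.norm_of_nonneg (mul_nonneg hr.1 (hf0 r).le)
      _ ≤ ∫ r in (0 : ℝ)..T, r * f r := hmono hR (hR.trans hTR : (0 : ℝ) ≤ T) hTR
      _ ≤ M := hT.le

/-- Ball's theorem: the radial integral of a log-concave function defines a convex function. -/
theorem convexOn_radial_integral {E : Type*} [AddCommGroup E] [Module ℝ E] {H : E → ℝ}
    (hH : ConvexOn ℝ univ H) :
    ConvexOn ℝ univ fun w : E =>
      (∫ r in Ioi (0 : ℝ), r * Real.exp (-H (r • w))) ^ (-(1 / 2 : ℝ)) := by
  have hcont : ∀ w : E, Continuous fun r : ℝ => Real.exp (-H (r • w)) := fun w => by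
    have h1 : ConvexOn ℝ univ fun r : ℝ => H (r • w) :=
      hH.comp_linearMap (LinearMap.toSpanSingleton ℝ E w)
    have h2 := continuousOn_univ.1 (h1.continuousOn isOpen_univ)
    exact Real.continuous_exp.comp h2.neg
  refine convexOn_iff_forall_pos.2 ⟨convex_univ, fun w₁ _ w₂ _ a b ha hb hab => ?_⟩
  have hlim := ((tendsto_truncated_radial (hcont w₁) fun r => Real.exp_pos _).const_mul a).add
    ((tendsto_truncated_radial (hcont w₂) fun r => Real.exp_pos _).const_mul b)
  refine ge_of_tendsto hlim ?_
  filter_upwards [Filter.eventually_gt_atTop 0] with R hR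
  by_cases hint : IntegrableOn (fun r => r * Real.exp (-H (r • (a • w₁ + b • w₂)))) (Ioi 0)
  · refine harmonic_radial_integral_le (hcont w₁) (hcont w₂) (fun r => Real.exp_pos _)
      (fun r => Real.exp_pos _) (fun r => Real.exp_pos _) ha hb (fun u v hu hv => ?_) hint hR hR
    set τ := (a / u + b / v)⁻¹ with hτ
    have hτ0 : 0 < τ := by positivity
    have hsum : a * τ / u + b * τ / v = 1 := by
      have : a * τ / u + b * τ / v = τ * (a / u + b / v) := by ring
      rw [this, hτ]
      exact inv_mul_cancel₀ (by positivity)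
    have h := hH.2 (mem_univ (u • w₁)) (mem_univ (v • w₂)) (show 0 ≤ a * τ / u by positivity)
      (show 0 ≤ b * τ / v by positivity) hsum
    have hpt : (a * τ / u) • u • w₁ + (b * τ / v) • v • w₂ = τ • (a • w₁ + b • w₂) := by
      rw [smul_smul, smul_smul, smul_add, smul_smul, smul_smul, div_mul_cancel₀ _ hu.ne',
        div_mul_cancel₀ _ hv.ne', mul_comm a, mul_comm b]
    rw [hpt] at h
    simp only [smul_eq_mul] at h
    rw [← Real.exp_mul, ← Real.exp_mul, ← Real.exp_add, Real.exp_le_exp]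
    linarith
  · rw [integral_undef hint, Real.zero_rpow (by norm_num)]
    have h : ∀ w, 0 ≤ ∫ r in (0 : ℝ)..R, r * Real.exp (-H (r • w)) := fun w =>
      intervalIntegral.integral_nonneg hR.le fun r hr => mul_nonneg hr.1 (Real.exp_pos _).le
    have := h w₁
    have := h w₂
    positivity

theorem integral_exp_convex_comb_le {Ω : Type*} [MeasurableSpace Ω] {μ : Measure Ω} {L₁ L₂ : Ω → ℝ}
    (h₁ : Integrable (fun ω => Real.exp (L₁ ω)) μ) (h₂ : Integrable (fun ω => Real.exp (L₂ ω)) μ)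
    {a b c₁ c₂ : ℝ} (ha : 0 < a) (hb : 0 < b) (hab : a + b = 1) (hc₁ : 0 < c₁) (hc₂ : 0 < c₂) :
    ∫ ω, Real.exp (a * L₁ ω + b * L₂ ω) ∂μ ≤
      c₁ ^ a * c₂ ^ b *
        (a * ((∫ ω, Real.exp (L₁ ω) ∂μ) / c₁) + b * ((∫ ω, Real.exp (L₂ ω) ∂μ) / c₂)) := by
  have hrhs : c₁ ^ a * c₂ ^ b *
        (a * ((∫ ω, Real.exp (L₁ ω) ∂μ) / c₁) + b * ((∫ ω, Real.exp (L₂ ω) ∂μ) / c₂)) =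
      ∫ ω, c₁ ^ a * c₂ ^ b * (a * (Real.exp (L₁ ω) / c₁) + b * (Real.exp (L₂ ω) / c₂)) ∂μ := by
    rw [integral_const_mul, integral_add ((h₁.div_const _).const_mul _)
      ((h₂.div_const _).const_mul _), integral_const_mul, integral_const_mul, integral_div,
      integral_div]
  rw [hrhs]
  refine integral_mono_of_nonneg (.of_forall fun ω => (Real.exp_pos _).le)
    ((((h₁.div_const _).const_mul _).add ((h₂.div_const _).const_mul _)).const_mul _)
    (.of_forall fun ω => ?_)
  have h := Real.geom_mean_le_arith_mean2_weighted ha.le hb.le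
    (p₁ := Real.exp (L₁ ω) / c₁) (p₂ := Real.exp (L₂ ω) / c₂) (by positivity) (by positivity) hab
  have e : Real.exp (a * L₁ ω + b * L₂ ω) =
      c₁ ^ a * c₂ ^ b * ((Real.exp (L₁ ω) / c₁) ^ a * (Real.exp (L₂ ω) / c₂) ^ b) := by
    rw [Real.div_rpow (Real.exp_pos _).le hc₁.le, Real.div_rpow (Real.exp_pos _).le hc₂.le,
      ← Real.exp_mul, ← Real.exp_mul, Real.exp_add, mul_comm a, mul_comm b]
    field_simp
  simp only
  rw [e]
  gcongr

/-- Log-convexity of a sum of two exponential integrals with linear exponents. -/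
theorem convexOn_log_add_integral_exp {E Ω : Type*} [AddCommGroup E] [Module ℝ E]
    [MeasurableSpace Ω] {μ ν : Measure Ω} [NeZero μ] (M N : E →ₗ[ℝ] Ω → ℝ)
    (hM : ∀ w, Integrable (fun ω => Real.exp (M w ω)) μ)
    (hN : ∀ w, Integrable (fun ω => Real.exp (N w ω)) ν) :
    ConvexOn ℝ univ fun w =>
      Real.log ((∫ ω, Real.exp (M w ω) ∂μ) + ∫ ω, Real.exp (N w ω) ∂ν) := by
  have hMpos : ∀ w, 0 < ∫ ω, Real.exp (M w ω) ∂μ := fun w => integral_exp_pos (hM w)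
  have hpos : ∀ w, 0 < (∫ ω, Real.exp (M w ω) ∂μ) + ∫ ω, Real.exp (N w ω) ∂ν := fun w =>
    add_pos_of_pos_of_nonneg (hMpos w) (integral_nonneg fun _ => (Real.exp_pos _).le)
  refine convexOn_iff_forall_pos.2 ⟨convex_univ, fun w₁ _ w₂ _ a b ha hb hab => ?_⟩
  have h1 := integral_exp_convex_comb_le (hM w₁) (hM w₂) ha hb hab (hpos w₁) (hpos w₂)
  have h2 := integral_exp_convex_comb_le (hN w₁) (hN w₂) ha hb hab (hpos w₁) (hpos w₂)
  have hp := hpos (a • w₁ + b • w₂)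
  have hp₁ := hpos w₁
  have hp₂ := hpos w₂
  simp only [map_add, map_smul, Pi.add_apply, Pi.smul_apply, smul_eq_mul] at hp ⊢
  set m₁ := ∫ ω, Real.exp (M w₁ ω) ∂μ
  set m₂ := ∫ ω, Real.exp (M w₂ ω) ∂μ
  set n₁ := ∫ ω, Real.exp (N w₁ ω) ∂ν
  set n₂ := ∫ ω, Real.exp (N w₂ ω) ∂ν
  rw [← Real.log_rpow hp₁, ← Real.log_rpow hp₂, ← Real.log_mul (by positivity) (by positivity)]
  refine Real.log_le_log hp ((add_le_add h1 h2).trans (le_of_eq ?_))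
  have e : a * (m₁ / (m₁ + n₁)) + b * (m₂ / (m₂ + n₂)) +
      (a * (n₁ / (m₁ + n₁)) + b * (n₂ / (m₂ + n₂))) = 1 := by
    rw [← hab]
    field_simp
    ring
  rw [← mul_add, e, mul_one]

theorem measurePreserving_shear {β : ℝ → ℝ} (hβ : Measurable β) :
    MeasurePreserving fun q : ℝ × ℝ => (q.1 + β q.2, q.2) := by
  have h : MeasurePreserving (fun q : ℝ × ℝ => (q.1, q.2 + β q.1))
      (volume.prod volume) (volume.prod volume) :=
    (MeasurePreserving.id volume).skew_product (g := fun s r => r + β s)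
      (by unfold Function.uncurry; fun_prop)
      (.of_forall fun s => (measurePreserving_add_right volume (β s)).map_eq)
  exact (Measure.measurePreserving_swap.comp h).comp Measure.measurePreserving_swap

theorem measurableEmbedding_shear {β : ℝ → ℝ} (hβ : Measurable β) :
    MeasurableEmbedding fun q : ℝ × ℝ => (q.1 + β q.2, q.2) :=
  MeasurableEquiv.measurableEmbedding
    { toFun := fun q => (q.1 + β q.2, q.2)
      invFun := fun q => (q.1 - β q.2, q.2)
      left_inv := fun q => by simp
      right_inv := fun q => by simp
      measurable_toFun := by simp only [Equiv.coe_fn_mk]; fun_prop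
      measurable_invFun := by simp only [Equiv.coe_fn_symm_mk]; fun_prop }

theorem convexHull_triangle_shear {x₁ x₃ y₁ y₂ : ℝ} (hy : y₁ < y₂) (t : ℝ) :
    convexHull ℝ ({(x₁, y₁), (t, y₂), (x₃, y₁)} : Set (ℝ × ℝ)) =
      (fun q : ℝ × ℝ => (q.1 + t * ((q.2 - y₁) / (y₂ - y₁)), q.2)) ''
        convexHull ℝ {(x₁, y₁), (0, y₂), (x₃, y₁)} := by
  have h0 : y₂ - y₁ ≠ 0 := (sub_pos.2 hy).ne'
  let S : ℝ × ℝ →ᵃ[ℝ] ℝ × ℝ :=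
    ((LinearMap.fst ℝ ℝ ℝ + (t / (y₂ - y₁)) • LinearMap.snd ℝ ℝ ℝ).prod
      (LinearMap.snd ℝ ℝ ℝ)).toAffineMap + AffineMap.const ℝ (ℝ × ℝ) (-(t * y₁ / (y₂ - y₁)), 0)
  have hS : (fun q : ℝ × ℝ => (q.1 + t * ((q.2 - y₁) / (y₂ - y₁)), q.2)) = S := by
    funext q
    ext
    · simp [S]; ring
    · simp [S]
  rw [hS, AffineMap.image_convexHull, ← hS]
  simp [image_insert_eq, h0]

theorem aedisjoint_of_convex_of_interior_inter_eq_empty {s t : Set (ℝ × ℝ)} (hs : Convex ℝ s)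
    (ht : Convex ℝ t) (h : interior s ∩ interior t = ∅) : AEDisjoint volume s t := by
  refine measure_mono_null (t := frontier s ∪ frontier t) (fun q hq => ?_)
    (measure_union_null (hs.addHaar_frontier volume) (ht.addHaar_frontier volume))
  by_contra hcon
  simp only [mem_union, not_or] at hcon
  have h1 : q ∈ interior s := by
    by_contra h'
    exact hcon.1 ⟨subset_closure hq.1, h'⟩
  have h2 : q ∈ interior t := by
    by_contra h'
    exact hcon.2 ⟨subset_closure hq.2, h'⟩
  exact h.subset ⟨h1, h2⟩

theorem suppFn_image_sub (p : ℝ) {K : Set (ℝ × ℝ)} (hK : 0 < (volume K).toReal)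
    {y : ℝ × ℝ} (hKint : 0 < ∫ q in K, Real.exp (p * (q.1 * y.1 + q.2 * y.2))) (hp : 0 < p)
    (c : ℝ × ℝ) :
    suppFn p ((fun q => q - c) '' K) y = suppFn p K y - (c.1 * y.1 + c.2 * y.2) := by
  have hmp := measurePreserving_sub_right (volume : Measure (ℝ × ℝ)) c
  have hemb := (MeasurableEquiv.subRight c).measurableEmbedding
  have hvol : volume ((fun q => q - c) '' K) = volume K := by
    rw [← hmp.measure_preimage_emb hemb, preimage_image_eq _ (sub_left_injective)]
  have hexp : ∀ q : ℝ × ℝ, Real.exp (p * ((q - c).1 * y.1 + (q - c).2 * y.2)) =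
      Real.exp (-(p * (c.1 * y.1 + c.2 * y.2))) * Real.exp (p * (q.1 * y.1 + q.2 * y.2)) := by
    intro q
    rw [← Real.exp_add, Prod.fst_sub, Prod.snd_sub]
    ring_nf
  unfold suppFn
  rw [hvol, hmp.setIntegral_image_emb hemb]
  simp only [hexp]
  rw [integral_const_mul, mul_div_assoc, Real.log_mul (Real.exp_pos _).ne' (by positivity),
    Real.log_exp]
  field_simp
  ring

/-- Lemma 5.3: for a Mahler sliding family `P(·)` on the interval `I`
and fixed `x ∈ ℝ`, the map `(y, t, x₀) ↦ ‖(x,y)‖_{(P(t)-(x₀,0))^{∘,p}}` is convex on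
`ℝ × I × ℝ`. -/
theorem norm_triple_convexity (p : ℝ) (hp : 0 < p)
    (x1 x3 y1 y2 : ℝ) (hx : x3 < x1) (hy : y1 < y2)
    (Phat : Set (ℝ × ℝ)) (hPcomp : IsCompact Phat) (hPconv : Convex ℝ Phat)
    (hPint : (interior Phat).Nonempty)
    (hseg : segment ℝ ((x3 : ℝ), y1) ((x1 : ℝ), y1) ⊆ Phat)
    (I : Set ℝ) (hI : Convex ℝ I)
    (Δ : ℝ → Set (ℝ × ℝ))
    (hΔ : ∀ t, Δ t = convexHull ℝ ({(x1, y1), (t, y2), (x3, y1)} : Set (ℝ × ℝ)))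
    (P : ℝ → Set (ℝ × ℝ))
    (hP : ∀ t, P t = convexHull ℝ (Phat ∪ ({(t, y2)} : Set (ℝ × ℝ))))
    (hdecomp : ∀ t ∈ I, P t = Phat ∪ Δ t ∧ interior Phat ∩ interior (Δ t) = ∅)
    (x : ℝ) :
    ConvexOn ℝ ((Set.univ : Set ℝ) ×ˢ I ×ˢ (Set.univ : Set ℝ))
      (fun z : ℝ × ℝ × ℝ =>
        nearNorm p ((fun q => q - ((z.2.2 : ℝ), (0 : ℝ))) '' P z.2.1) (x, z.1)) := by
  have hΔcomp : ∀ t, IsCompact (Δ t) := fun t => by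
    rw [hΔ]
    exact (Set.toFinite _).isCompact_convexHull ℝ
  have hPhatvol : 0 < volume Phat :=
    (isOpen_interior.measure_pos volume hPint).trans_le (measure_mono interior_subset)
  set β : ℝ → ℝ := fun s => (s - y1) / (y2 - y1) with hβ
  have hβc : Continuous β := by fun_prop
  set V : ℝ := volume.real Phat + volume.real (Δ 0) with hV
  have hV0 : 0 < V := add_pos_of_pos_of_nonneg
    (ENNReal.toReal_pos hPhatvol.ne' hPcomp.measure_lt_top.ne) measureReal_nonneg
  let M : ℝ × ℝ × ℝ × ℝ →ₗ[ℝ] ℝ × ℝ → ℝ :=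
    { toFun := fun w q => p * (q.1 * w.1 + q.2 * w.2.1)
      map_add' := fun w w' => by funext q; simp; ring
      map_smul' := fun c w => by funext q; simp; ring }
  let N : ℝ × ℝ × ℝ × ℝ →ₗ[ℝ] ℝ × ℝ → ℝ :=
    { toFun := fun w q => p * (q.1 * w.1 + q.2 * w.2.1 + β q.2 * w.2.2.1)
      map_add' := fun w w' => by funext q; simp; ring
      map_smul' := fun c w => by funext q; simp; ring }
  have hMc : ∀ w, Continuous fun q => Real.exp (M w q) := fun w => by
    simp only [M, LinearMap.coe_mk, AddHom.coe_mk]; fun_prop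
  have hNc : ∀ w, Continuous fun q => Real.exp (N w q) := fun w => by
    simp only [N, LinearMap.coe_mk, AddHom.coe_mk]; fun_prop
  have hne : NeZero (volume.restrict Phat) := ⟨by
    rw [Ne, Measure.restrict_eq_zero]
    exact hPhatvol.ne'⟩
  have hMi : ∀ w, IntegrableOn (fun q => Real.exp (M w q)) Phat := fun w =>
    (hMc w).continuousOn.integrableOn_compact hPcomp
  have hNi : ∀ w, IntegrableOn (fun q => Real.exp (N w q)) (Δ 0) := fun w =>
    (hNc w).continuousOn.integrableOn_compact (hΔcomp 0)
  set F : ℝ × ℝ × ℝ × ℝ → ℝ := fun w =>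
    (∫ q in Phat, Real.exp (M w q)) + ∫ q in Δ 0, Real.exp (N w q) with hF
  have hF0 : ∀ w, 0 < F w := fun w =>
    add_pos_of_pos_of_nonneg (integral_exp_pos (hMi w))
      (integral_nonneg fun _ => (Real.exp_pos _).le)
  set H : ℝ × ℝ × ℝ × ℝ → ℝ := fun w => (1 / p) * Real.log (F w / V) - w.2.2.2 with hH
  have hHconv : ConvexOn ℝ univ H := by
    have h1 := ((convexOn_log_add_integral_exp M N hMi hNi).add_const (-Real.log V)).smul
      (one_div_pos.2 hp).le
    have h2 : ConcaveOn ℝ univ fun w : ℝ × ℝ × ℝ × ℝ => w.2.2.2 :=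
      ((LinearMap.snd ℝ ℝ ℝ).comp ((LinearMap.snd ℝ ℝ (ℝ × ℝ)).comp
        (LinearMap.snd ℝ ℝ (ℝ × ℝ × ℝ)))).concaveOn convex_univ
    refine (h1.sub h2).congr fun w _ => ?_
    simp only [hH, hF, Pi.sub_apply, Pi.add_apply, smul_eq_mul]
    rw [Real.log_div (hF0 w).ne' hV0.ne', sub_eq_add_neg (Real.log _)]
  have hsupp : ∀ t ∈ I, ∀ x₀ : ℝ, ∀ y : ℝ × ℝ,
      suppFn p ((fun q => q - (x₀, (0 : ℝ))) '' P t) y = H (y.1, y.2, t * y.1, x₀ * y.1) := by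
    intro t ht x₀ y
    obtain ⟨hPt, hdisj⟩ := hdecomp t ht
    have hae : AEDisjoint volume Phat (Δ t) :=
      aedisjoint_of_convex_of_interior_inter_eq_empty hPconv
        (by rw [hΔ]; exact convex_convexHull ℝ _) hdisj
    have hmp := measurePreserving_shear (β := fun s => t * β s) (by fun_prop)
    have hemb := measurableEmbedding_shear (β := fun s => t * β s) (by fun_prop)
    have hshear : Δ t = (fun q : ℝ × ℝ => (q.1 + t * β q.2, q.2)) '' Δ 0 := by
      rw [hΔ, hΔ, convexHull_triangle_shear hy]
    have hΔvol : volume (Δ t) = volume (Δ 0) := by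
      rw [hshear, ← hmp.measure_preimage_emb hemb, preimage_image_eq _ hemb.injective]
    have hvol : (volume (P t)).toReal = V := by
      rw [hPt, measure_union₀ (hΔcomp t).measurableSet.nullMeasurableSet hae, hΔvol,
        ENNReal.toReal_add hPcomp.measure_lt_top.ne (hΔcomp 0).measure_lt_top.ne]
      rfl
    have hint : ∫ q in P t, Real.exp (p * (q.1 * y.1 + q.2 * y.2)) =
        F (y.1, y.2, t * y.1, x₀ * y.1) := by
      have hc : Continuous fun q : ℝ × ℝ => Real.exp (p * (q.1 * y.1 + q.2 * y.2)) := by fun_prop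
      rw [hPt, setIntegral_union₀ hae (hΔcomp t).measurableSet.nullMeasurableSet
        (hc.continuousOn.integrableOn_compact hPcomp)
        (hc.continuousOn.integrableOn_compact (hΔcomp t)), hshear, hmp.setIntegral_image_emb hemb]
      simp only [hF, M, N, LinearMap.coe_mk, AddHom.coe_mk]
      congr 1
      refine integral_congr_ae (.of_forall fun q => ?_)
      simp only
      ring_nf
    rw [suppFn_image_sub p (hvol ▸ hV0) (hint ▸ hF0 _) hp, suppFn, hvol, hint]
    simp [hH]
  have hnorm : ∀ t ∈ I, ∀ x₀ y : ℝ, nearNorm p ((fun q => q - (x₀, (0 : ℝ))) '' P t) (x, y) =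
      (∫ r in Ioi (0 : ℝ), r * Real.exp (-H (r • (x, y, t * x, x₀ * x)))) ^ (-(1 / 2 : ℝ)) := by
    intro t ht x₀ y
    unfold nearNorm
    split_ifs with h0
    · obtain ⟨rfl, rfl⟩ := Prod.mk_eq_zero.1 h0
      have hw : ((0 : ℝ), (0 : ℝ), t * 0, x₀ * 0) = (0 : ℝ × ℝ × ℝ × ℝ) := by simp
      have hni : ¬IntegrableOn (fun r : ℝ => r * Real.exp (-H 0)) (Ioi 0) := fun h => by
        have h1 := h.mul_const (Real.exp (-H 0))⁻¹
        refine not_integrableOn_Ioi_rpow 1 (h1.congr (.of_forall fun r => ?_))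
        simp
      simp only [hw, smul_zero]
      rw [integral_undef hni, Real.zero_rpow (by norm_num)]
    · congr 2
      funext r
      rw [hsupp t ht]
      simp only [Prod.smul_mk, smul_eq_mul]
      ring_nf
  have hball := convexOn_radial_integral hHconv
  refine ⟨convex_univ.prod (hI.prod convex_univ), fun z hz z' hz' a b ha hb hab => ?_⟩
  have hz'' := convex_univ.prod (hI.prod convex_univ) hz hz' ha hb hab
  simp only
  rw [hnorm _ hz.2.1, hnorm _ hz'.2.1, hnorm _ hz''.2.1]
  have h := hball.2 (mem_univ (x, z.1, z.2.1 * x, z.2.2 * x))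
    (mem_univ (x, z'.1, z'.2.1 * x, z'.2.2 * x)) ha hb hab
  have hpt : a • (x, z.1, z.2.1 * x, z.2.2 * x) + b • (x, z'.1, z'.2.1 * x, z'.2.2 * x) =
      (x, (a • z + b • z').1, (a • z + b • z').2.1 * x, (a • z + b • z').2.2 * x) := by
    simp only [Prod.smul_mk, Prod.mk_add_mk, Prod.fst_add, Prod.snd_add, Prod.smul_fst,
      Prod.smul_snd, smul_eq_mul, Prod.mk.injEq, true_and]
    exact ⟨by rw [← add_mul, hab, one_mul], by ring, by ring⟩
  rw [hpt] at h
  exact h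
end

section
/- Let m ∈ ℕ and let f : ℝ × ℝ^m → (0,∞) be a convex function. Then the function g : ℝ^m → [0,∞) defined by g(y) := ( ∫_ℝ f(z,y)^{−2} dz )^{−1}, with g(y) := 0 when the integral diverges, is convex on ℝ^m. -/
open MeasureTheory Set

open Filter Topology intervalIntegral

/-- A primitive of a continuous function that is bounded below by a positive constant is an
order isomorphism of the real line, with differentiable inverse. -/
theorem exists_hasDerivAt_inverse_primitive {h : ℝ → ℝ} (hc : Continuous h) {δ : ℝ} (hδ : 0 < δ)
    (hb : ∀ x, δ ≤ h x) (r : ℝ) :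
    ∃ e : ℝ ≃o ℝ, (∀ x, e x = ∫ t in r..x, h t) ∧
      ∀ y, HasDerivAt e.symm (h (e.symm y))⁻¹ y := by
  have hint : ∀ a b, IntervalIntegrable h volume a b := fun a b => hc.intervalIntegrable a b
  have hd : ∀ x, HasDerivAt (fun x => ∫ t in r..x, h t) (h x) x := fun x =>
    integral_hasDerivAt_right (hint _ _) (hc.stronglyMeasurableAtFilter _ _) hc.continuousAt
  have hcont : Continuous (fun x => ∫ t in r..x, h t) :=
    continuous_iff_continuousAt.2 fun x => (hd x).continuousAt
  have hgrow : ∀ {x y}, x ≤ y → δ * (y - x) ≤ (∫ t in r..y, h t) - ∫ t in r..x, h t := by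
    intro x y hxy
    rw [integral_interval_sub_left (hint _ _) (hint _ _)]
    calc δ * (y - x) = ∫ _ in x..y, δ := by simp [mul_comm]
      _ ≤ _ := integral_mono_on hxy (by simp) (hint _ _) fun t _ => hb t
  have hmono : StrictMono (fun x => ∫ t in r..x, h t) := by
    intro x y hxy
    have h1 := hgrow hxy.le
    have h2 : 0 < δ * (y - x) := mul_pos hδ (sub_pos.2 hxy)
    simp only
    linarith
  have htop : Tendsto (fun x => ∫ t in r..x, h t) atTop atTop := by
    refine tendsto_atTop_mono' _ ?_
      ((tendsto_atTop_add_const_right _ (-r) tendsto_id).const_mul_atTop hδ)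
    filter_upwards [eventually_ge_atTop r] with x hx
    simpa [sub_eq_add_neg] using hgrow hx
  have hbot : Tendsto (fun x => ∫ t in r..x, h t) atBot atBot := by
    refine tendsto_atBot_mono' _ ?_
      ((tendsto_atBot_add_const_right _ (-r) tendsto_id).const_mul_atBot hδ)
    filter_upwards [eventually_le_atBot r] with x hx
    have := hgrow hx
    simp only [integral_same, id] at this ⊢
    linarith
  let e := hmono.orderIsoOfSurjective _ (hcont.surjective htop hbot)
  have he : ∀ x, e x = ∫ t in r..x, h t := fun _ => rfl
  refine ⟨e, he, fun y => ?_⟩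
  exact HasDerivAt.of_local_left_inverse e.symm.continuous.continuousAt (hd _)
    (hδ.trans_le (hb _)).ne' (Eventually.of_forall fun y => e.apply_symm_apply y)

/-- The one-dimensional Borell-Brascamp-Lieb inequality with exponent `-1/2` on a bounded
interval. -/
theorem inv_integral_inv_sq_le {a b c : ℝ → ℝ} (ha : Continuous a) (hb : Continuous b)
    (hc : Continuous c) (ha0 : ∀ x, 0 < a x) (hb0 : ∀ x, 0 < b x) (hc0 : ∀ x, 0 < c x)
    {p q : ℝ} (hp : 0 ≤ p) (hq : 0 ≤ q) (hpq : p + q = 1)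
    (habc : ∀ s t, c (p * s + q * t) ≤ p * a s + q * b t) {l r : ℝ} (hlr : l < r) :
    (∫ x in l..r, (c x ^ 2)⁻¹)⁻¹ ≤
      p * (∫ x in l..r, (a x ^ 2)⁻¹)⁻¹ + q * (∫ x in l..r, (b x ^ 2)⁻¹)⁻¹ := by
  have cont : ∀ {u : ℝ → ℝ}, Continuous u → (∀ x, 0 < u x) → Continuous fun x => (u x ^ 2)⁻¹ :=
    fun hu hu0 => (hu.pow 2).inv₀ fun x => (pow_pos (hu0 x) 2).ne'
  have ipos : ∀ {u : ℝ → ℝ}, Continuous u → (∀ x, 0 < u x) → 0 < ∫ x in l..r, (u x ^ 2)⁻¹ :=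
    fun hu hu0 => intervalIntegral_pos_of_pos ((cont hu hu0).intervalIntegrable _ _)
      (fun x => inv_pos.2 (pow_pos (hu0 x) 2)) hlr
  have ca := cont ha ha0
  have cb := cont hb hb0
  have cc := cont hc hc0
  have hA := ipos ha ha0
  have hB := ipos hb hb0
  set A := ∫ x in l..r, (a x ^ 2)⁻¹ with hAdef
  set B := ∫ x in l..r, (b x ^ 2)⁻¹ with hBdef
  set C := ∫ x in l..r, (c x ^ 2)⁻¹
  let h : ℝ → ℝ := IccExtend hlr.le ((Icc l r).domRestrict fun x => (b x ^ 2)⁻¹)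
  have hh : ∀ x ∈ Icc l r, h x = (b x ^ 2)⁻¹ := fun x hx => by
    simp [h, IccExtend_of_mem _ _ hx]
  have hhc : Continuous h := (cb.comp continuous_subtype_val).Icc_extend'
  obtain ⟨x₀, -, hx₀⟩ := isCompact_Icc.exists_isMinOn (nonempty_Icc.2 hlr.le) cb.continuousOn
  have hbd : ∀ x, (b x₀ ^ 2)⁻¹ ≤ h x := fun x => hx₀ (projIcc l r hlr.le x).2
  obtain ⟨e, he, hde⟩ := exists_hasDerivAt_inverse_primitive hhc
    (inv_pos.2 (pow_pos (hb0 x₀) 2)) hbd l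
  have hel : e l = 0 := by simp [he]
  have her : e r = B := by
    rw [he, hBdef]
    exact integral_congr fun x hx => hh x (by rwa [uIcc_of_le hlr.le] at hx)
  let F : ℝ → ℝ := fun s => B / A * ∫ x in l..s, (a x ^ 2)⁻¹
  have hF : ∀ s, HasDerivAt F (B / A * (a s ^ 2)⁻¹) s := fun s =>
    (integral_hasDerivAt_right (ca.intervalIntegrable _ _) (ca.stronglyMeasurableAtFilter _ _)
      ca.continuousAt).const_mul _
  have hFmono : Monotone F := monotone_of_deriv_nonneg (fun s => (hF s).differentiableAt)
    fun s => by
      rw [(hF s).deriv]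
      have := ha0 s
      positivity
  let T : ℝ → ℝ := fun s => e.symm (F s)
  have hTl : T l = l := by
    have : F l = 0 := by simp [F]
    simp [T, this, ← hel]
  have hTr : T r = r := by
    have : F r = B := by simp only [F]; rw [← hAdef]; field_simp
    simp [T, this, ← her]
  have hTmono : Monotone T := e.symm.monotone.comp hFmono
  have hTmem : ∀ s ∈ Icc l r, T s ∈ Icc l r := fun s hs =>
    ⟨hTl ▸ hTmono hs.1, (hTmono hs.2).trans_eq hTr⟩
  have hT : ∀ s, HasDerivAt T ((h (T s))⁻¹ * (B / A * (a s ^ 2)⁻¹)) s := fun s =>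
    (hde (F s)).comp s (hF s)
  have hTc : Continuous T := continuous_iff_continuousAt.2 fun s => (hT s).continuousAt
  let z' : ℝ → ℝ := fun s => p + q * ((h (T s))⁻¹ * (B / A * (a s ^ 2)⁻¹))
  have hz : ∀ s, HasDerivAt (fun s => p * s + q * T s) (z' s) s := fun s => by
    have := ((hasDerivAt_id s).const_mul p).add ((hT s).const_mul q)
    rw [mul_one] at this
    exact this
  have hz'c : Continuous z' := by
    have : Continuous fun s => (h (T s))⁻¹ := (hhc.comp hTc).inv₀ fun s =>
      ((inv_pos.2 (pow_pos (hb0 x₀) 2)).trans_le (hbd _)).ne'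
    fun_prop
  have hchange : ∫ s in l..r, (c (p * s + q * T s) ^ 2)⁻¹ * z' s = C := by
    have := integral_comp_mul_deriv (a := l) (b := r) (g := fun x => (c x ^ 2)⁻¹)
      (fun s _ => hz s) hz'c.continuousOn cc
    simp only [Function.comp_def, hTl, hTr, ← add_mul, hpq, one_mul] at this
    exact this
  let D := p * A⁻¹ + q * B⁻¹
  have hD : 0 < D := by
    rcases hp.eq_or_lt with rfl | hp
    · have : q = 1 := by linarith
      simp only [D, this]; positivity
    · simp only [D]; positivity
  have hpt : ∀ s ∈ Icc l r, (a s ^ 2)⁻¹ * (A⁻¹ * D⁻¹) ≤ (c (p * s + q * T s) ^ 2)⁻¹ * z' s := by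
    intro s hs
    have hcs := habc s (T s)
    have h0 := hc0 (p * s + q * T s)
    simp only [z', hh _ (hTmem s hs), inv_inv]
    have hα := ha0 s
    have hβ := hb0 (T s)
    generalize c (p * s + q * T s) = γ at *
    generalize a s = α at *
    generalize b (T s) = β at *
    have key : γ ^ 2 ≤ (p * A * α ^ 2 + q * B * β ^ 2) * D := by
      calc γ ^ 2 ≤ (p * α + q * β) ^ 2 := by gcongr
        _ ≤ (p * A * α ^ 2 + q * B * β ^ 2) * D := by
          have : (p * A * α ^ 2 + q * B * β ^ 2) * D - (p * α + q * β) ^ 2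
              = p * q * (A * α - B * β) ^ 2 / (A * B) := by
            simp only [D]; field_simp; ring
          have : 0 ≤ p * q * (A * α - B * β) ^ 2 / (A * B) := by positivity
          linarith
    have e1 : (γ ^ 2)⁻¹ * (p + q * (β ^ 2 * (B / A * (α ^ 2)⁻¹))) =
        (p * A * α ^ 2 + q * B * β ^ 2) / (γ ^ 2 * (A * α ^ 2)) := by
      field_simp
    have e2 : (α ^ 2)⁻¹ * (A⁻¹ * D⁻¹) = 1 / (α ^ 2 * A * D) := by
      field_simp
    rw [e1, e2, div_le_div_iff₀ (by positivity) (by positivity)]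
    nlinarith [mul_le_mul_of_nonneg_left key (by positivity : 0 ≤ A * α ^ 2)]
  have hle : D⁻¹ ≤ C := by
    calc D⁻¹ = ∫ s in l..r, (a s ^ 2)⁻¹ * (A⁻¹ * D⁻¹) := by
          rw [intervalIntegral.integral_mul_const, ← hAdef]; field_simp
      _ ≤ ∫ s in l..r, (c (p * s + q * T s) ^ 2)⁻¹ * z' s := by
          refine integral_mono_on hlr.le ((ca.mul continuous_const).intervalIntegrable _ _)
            (Continuous.intervalIntegrable ?_ _ _) hpt
          exact (cc.comp (by fun_prop : Continuous fun s => p * s + q * T s)).mul hz'c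
      _ = C := hchange
  exact inv_le_of_inv_le₀ hD hle

/-- The reciprocals of the integrals of a positive continuous function over `[-n, n]` converge to
the reciprocal of its integral over the line, even when the latter is infinite. -/
theorem tendsto_inv_integral_Icc {u : ℝ → ℝ} (hu : Continuous u) (hu0 : ∀ x, 0 < u x) :
    Tendsto (fun n : ℕ => (∫ x in (-n : ℝ)..n, u x)⁻¹) atTop
      (𝓝 ((∫⁻ x, ENNReal.ofReal (u x))⁻¹).toReal) := by
  have hcover : AECover volume atTop fun n : ℕ => Icc (-n : ℝ) n :=
    aecover_Icc (tendsto_neg_atTop_atBot.comp tendsto_natCast_atTop_atTop)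
      tendsto_natCast_atTop_atTop
  have hlim := hcover.lintegral_tendsto_of_countably_generated
    (hu.measurable.ennreal_ofReal.aemeasurable)
  have hne : ∫⁻ x, ENNReal.ofReal (u x) ≠ 0 := by
    rw [Ne, lintegral_eq_zero_iff hu.measurable.ennreal_ofReal]
    intro h
    obtain ⟨x, hx⟩ := h.exists
    simp only [Pi.zero_apply, ENNReal.ofReal_eq_zero] at hx
    exact absurd (hu0 x) hx.not_gt
  refine ((ENNReal.tendsto_toReal (ENNReal.inv_ne_top.2 hne)).comp
    (tendsto_inv_iff.2 hlim)).congr fun n => ?_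
  have hn : (-n : ℝ) ≤ n := by linarith [n.cast_nonneg (α := ℝ)]
  rw [Function.comp_apply, ENNReal.toReal_inv, integral_of_le hn, ← integral_Icc_eq_integral_Ioc,
    integral_eq_lintegral_of_nonneg_ae (Eventually.of_forall fun x => (hu0 x).le)
      hu.aestronglyMeasurable]

/-- Lemma A.1, consequence of Borell--Brascamp--Lieb: for a positive
convex function `f : ℝ × ℝᵐ → (0,∞)`, the function
`y ↦ (∫_ℝ f(z,y)⁻² dz)⁻¹` (set to `0` when the integral diverges) is convex on `ℝᵐ`. -/
theorem reciprocal_integral_convex (m : ℕ)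
    (f : ℝ × (Fin m → ℝ) → ℝ) (hfpos : ∀ z, 0 < f z)
    (hfconv : ConvexOn ℝ Set.univ f) :
    ConvexOn ℝ Set.univ (fun y : Fin m → ℝ =>
      ((∫⁻ z : ℝ, ENNReal.ofReal ((f (z, y) ^ 2)⁻¹))⁻¹).toReal) := by
  have hf : Continuous f := continuousOn_univ.1 (hfconv.continuousOn isOpen_univ)
  have hs : ∀ y, Continuous fun z => f (z, y) := fun y => hf.comp (by fun_prop)
  have hlim := fun y => tendsto_inv_integral_Icc
    (((hs y).pow 2).inv₀ fun z => (pow_pos (hfpos (z, y)) 2).ne')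
    (fun z => inv_pos.2 (pow_pos (hfpos (z, y)) 2))
  refine ⟨convex_univ, fun x _ y _ p q hp hq hpq => ?_⟩
  refine le_of_tendsto_of_tendsto (hlim (p • x + q • y))
    (((hlim x).const_mul p).add ((hlim y).const_mul q)) ?_
  filter_upwards [eventually_gt_atTop 0] with n hn
  have hn : (0 : ℝ) < n := Nat.cast_pos.2 hn
  exact inv_integral_inv_sq_le (hs x) (hs y) (hs _) (fun _ => hfpos _) (fun _ => hfpos _)
    (fun _ => hfpos _) hp hq hpq
    (fun s t => hfconv.2 (mem_univ (s, x)) (mem_univ (t, y)) hp hq hpq) (by linarith)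
end
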